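/- There exists a choice of the constants C₁ < ⋯ < C_{d−1} and D₁ < ⋯ < D_{d−1} (with C₀ = D₀ = 1), depending only on d, ε, δ, τ, 𝔠 and 𝔉, such that the sets E⁽⁰⁾, E⁽ᵈ⁾ and E⁽ˢ⁾_M (for 1 ≤ s ≤ d−1 and M ranging over the submodules of ℤ^d of dimension s) are pairwise disjoint and their union is E. Moreover E⁽ᵈ⁾ is finite, with cardinality bounded by a number n* depending only on 𝔠, 𝔉, δ, ε, τ and d, and if E = ℤ^d then E⁽⁰⁾ has density one at infinity, i.e. #(E⁽⁰⁾ ∩ B_R)/#(ℤ^d ∩ B_R) → 1 as R → ∞, where B_R := {ξ ∈ ℝ^d : ‖ξ‖ ≤ R}. -/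

import Mathlib

/-- A positive definite symmetric bilinear form on `ℝ^d`. -/
structure PDForm (d : ℕ) where
  B : (Fin d → ℝ) →ₗ[ℝ] (Fin d → ℝ) →ₗ[ℝ] ℝ
  symm : ∀ x y, B x y = B y x
  posdef : ∀ x, x ≠ 0 → 0 < B x x

namespace PDForm

variable {d : ℕ} (g : PDForm d)

/-- The inner product `⟨·,·⟩` associated with the form. -/
def inn (x y : Fin d → ℝ) : ℝ := g.B x y

/-- The norm `‖·‖` associated with the form. -/
noncomputable def nrm (x : Fin d → ℝ) : ℝ := Real.sqrt (g.inn x x)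

/-- The Japanese bracket `⟨x⟩ = (1+‖x‖²)^{1/2}`. -/
noncomputable def jap (x : Fin d → ℝ) : ℝ := Real.sqrt (1 + g.inn x x)

end PDForm

/-- Cast of a lattice vector of `ℤ^d` into `ℝ^d`. -/
def zc {d : ℕ} (k : Fin d → ℤ) : Fin d → ℝ := fun i => (k i : ℝ)

/-- `𝔠 := min{‖k‖² : k ∈ ℤ^d, k ≠ 0}`. -/
noncomputable def frakc {d : ℕ} (g : PDForm d) : ℝ :=
  sInf {x | ∃ k : Fin d → ℤ, k ≠ 0 ∧ x = (g.nrm (zc k)) ^ 2}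

/-- Gram volume `√det(⟨u_i,u_j⟩)` of an `s`-tuple of vectors. -/
noncomputable def gvol {d s : ℕ} (g : PDForm d) (u : Fin s → (Fin d → ℝ)) : ℝ :=
  Real.sqrt (Matrix.det (Matrix.of fun i j => g.inn (u i) (u j)))

/-- `𝔉`, the minimal Gram volume of parallelepipeds with linearly independent integer edges. -/
noncomputable def frakC {d : ℕ} (g : PDForm d) : ℝ :=
  sInf {x | ∃ (s : ℕ) (u : Fin s → (Fin d → ℤ)), 1 ≤ s ∧ s ≤ d ∧
    LinearIndependent ℝ (fun j => zc (u j)) ∧ x = gvol g (fun j => zc (u j))}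

/-- A submodule of `ℤ^d` in the sense of the paper: `span_ℝ(M) ∩ ℤ^d = M`. -/
def IsSat {d : ℕ} (M : Submodule ℤ (Fin d → ℤ)) : Prop :=
  ∀ k : Fin d → ℤ, zc k ∈ Submodule.span ℝ (zc '' (M : Set (Fin d → ℤ))) → k ∈ M

/-- The dimension (rank) of a submodule of `ℤ^d`. -/
noncomputable def zrank {d : ℕ} (M : Submodule ℤ (Fin d → ℤ)) : ℕ := Module.finrank ℤ M

/-- `ξ_k := ξ + κ + k/2`. -/
noncomputable def xik {d : ℕ} (κ : Fin d → ℝ) (ξ k : Fin d → ℤ) : Fin d → ℝ :=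
  fun i => (ξ i : ℝ) + κ i + (k i : ℝ) / 2

/-- All the data entering the definition of the resonant zones. -/
structure ZoneData (d : ℕ) where
  g : PDForm d
  κ : Fin d → ℝ
  E : Set (Fin d → ℤ)
  δ : ℝ
  ε : ℝ
  τ : ℝ
  Cs : ℕ → ℝ
  Ds : ℕ → ℝ

namespace ZoneData

variable {d : ℕ} (Z : ZoneData d)

/-- `δ_s := δ + s (d+τ+1) ε`. -/
noncomputable def δs (s : ℕ) : ℝ := Z.δ + s * ((d + Z.τ + 1) * Z.ε)

/-- The completely nonresonant zone `Z⁽⁰⁾`. -/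
noncomputable def Z0 : Set (Fin d → ℤ) :=
  {ξ | ξ ∈ Z.E ∧ ∀ k : Fin d → ℤ, k ≠ 0 →
    Z.g.nrm (zc k) ≤ (Z.g.jap (xik Z.κ ξ k)) ^ Z.ε →
    |Z.g.inn (xik Z.κ ξ k) (zc k)| >
      (Z.g.jap (xik Z.κ ξ k)) ^ Z.δ * (Z.g.nrm (zc k)) ^ (-Z.τ)}

/-- The resonant zone `Z⁽ˢ⁾_M`, union over linearly independent `s`-tuples in `M`
of the zones `Z_{k₁,…,k_s}`. -/
noncomputable def ZM (s : ℕ) (M : Submodule ℤ (Fin d → ℤ)) : Set (Fin d → ℤ) :=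
  {ξ | ξ ∈ Z.E ∧ ∃ (hs : 0 < s) (k : Fin s → (Fin d → ℤ)),
    (∀ j, k j ∈ M) ∧ LinearIndependent ℝ (fun j => zc (k j)) ∧
    ∀ j : Fin s,
      |Z.g.inn (xik Z.κ ξ (k ⟨0, hs⟩)) (zc (k j))| ≤
        Z.Cs j * (Z.g.jap (xik Z.κ ξ (k ⟨0, hs⟩))) ^ (Z.δs j) * (Z.g.nrm (zc (k j))) ^ (-Z.τ) ∧
      Z.g.nrm (zc (k j)) ≤ Z.Ds j * (Z.g.jap (xik Z.κ ξ (k ⟨0, hs⟩))) ^ Z.ε}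

/-- The resonant block `B⁽ˢ⁾_M`. -/
noncomputable def BM (s : ℕ) (M : Submodule ℤ (Fin d → ℤ)) : Set (Fin d → ℤ) :=
  Z.ZM s M \
    ⋃ (M' : Submodule ℤ (Fin d → ℤ)) (_ : IsSat M' ∧ zrank M' = s + 1), Z.ZM (s + 1) M'

/-- The extended block `E⁽ˢ⁾_M` (for `s ≥ 1`). -/
noncomputable def EM : ℕ → Submodule ℤ (Fin d → ℤ) → Set (Fin d → ℤ)
  | s, M =>
    {ξ | (∃ b ∈ Z.BM s M, ∃ m ∈ M, ξ = b + m) ∧ ξ ∈ Z.ZM s M ∧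
      ∀ r, 1 ≤ r → r < s → ∀ M' : Submodule ℤ (Fin d → ℤ),
        IsSat M' → zrank M' = r → ξ ∉ EM r M'}
  termination_by s => s

end ZoneData

/-- Conditions on the parameters `δ, ε, τ`. -/
def ParamsOK (d : ℕ) (δ ε τ : ℝ) : Prop :=
  1 ≤ d ∧ 0 < δ ∧ δ < 1 ∧ 0 < ε ∧ (d : ℝ) - 1 < τ ∧
    δ + d * ((d + τ + 1) * ε) < 1 ∧ ε * (τ + 1) ≤ δ

/-- Conditions `1 = C₀ < C₁ < ⋯ < C_{d-1}` and `1 = D₀ < D₁ < ⋯ < D_{d-1}`. -/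
def SeqOK (d : ℕ) (Cs Ds : ℕ → ℝ) : Prop :=
  Cs 0 = 1 ∧ Ds 0 = 1 ∧ (∀ j, j + 2 ≤ d → Cs j < Cs (j + 1)) ∧
    (∀ j, j + 2 ≤ d → Ds j < Ds (j + 1))

namespace PDForm

variable {d : ℕ} (g : PDForm d)

lemma inn_self_nonneg (x : Fin d → ℝ) : 0 ≤ g.inn x x := by
  by_cases hx : x = 0
  · simp [inn, hx]
  · exact (g.posdef x hx).le

lemma nrm_nonneg (x : Fin d → ℝ) : 0 ≤ g.nrm x := Real.sqrt_nonneg _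

lemma nrm_sq (x : Fin d → ℝ) : g.nrm x ^ 2 = g.inn x x := Real.sq_sqrt (g.inn_self_nonneg x)

lemma abs_inn_le (x y : Fin d → ℝ) : |g.inn x y| ≤ g.nrm x * g.nrm y := by
  have h := LinearMap.BilinForm.apply_mul_apply_le_of_forall_zero_le g.B g.inn_self_nonneg x y
  apply abs_le_of_sq_le_sq _ (mul_nonneg (g.nrm_nonneg x) (g.nrm_nonneg y))
  rw [mul_pow, nrm_sq, nrm_sq, sq]
  rwa [g.symm y x] at h

lemma nrm_add_le (x y : Fin d → ℝ) : g.nrm (x + y) ≤ g.nrm x + g.nrm y := by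
  refine abs_le_of_sq_le_sq' ?_ (add_nonneg (g.nrm_nonneg x) (g.nrm_nonneg y)) |>.2
  have h : g.inn (x + y) (x + y) = g.inn x x + 2 * g.inn x y + g.inn y y := by
    simp only [inn, map_add, LinearMap.add_apply, g.symm y x]
    ring
  rw [nrm_sq, h, ← nrm_sq, ← nrm_sq]
  nlinarith [le_abs_self (g.inn x y), g.abs_inn_le x y]

lemma nrm_smul (a : ℝ) (x : Fin d → ℝ) : g.nrm (a • x) = |a| * g.nrm x := by
  have h : g.inn (a • x) (a • x) = a ^ 2 * g.inn x x := by
    simp only [inn, map_smul, LinearMap.smul_apply, smul_eq_mul]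
    ring
  rw [nrm, h, Real.sqrt_mul (sq_nonneg a), Real.sqrt_sq_eq_abs, nrm]

lemma nrm_neg (x : Fin d → ℝ) : g.nrm (-x) = g.nrm x := by
  simpa using g.nrm_smul (-1) x

lemma nrm_zero : g.nrm 0 = 0 := by simp [nrm, inn]

lemma nrm_sub_le (x y : Fin d → ℝ) : g.nrm (x - y) ≤ g.nrm x + g.nrm y := by
  simpa [sub_eq_add_neg, nrm_neg] using g.nrm_add_le x (-y)

lemma nrm_sum_le {ι : Type*} (s : Finset ι) (f : ι → Fin d → ℝ) :
    g.nrm (∑ i ∈ s, f i) ≤ ∑ i ∈ s, g.nrm (f i) :=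
  Finset.le_sum_of_subadditive _ g.nrm_zero.le g.nrm_add_le _ _

lemma one_le_jap (x : Fin d → ℝ) : 1 ≤ g.jap x := by
  rw [jap, Real.one_le_sqrt]
  linarith [g.inn_self_nonneg x]

lemma jap_pos (x : Fin d → ℝ) : 0 < g.jap x := one_pos.trans_le (g.one_le_jap x)

lemma nrm_le_jap (x : Fin d → ℝ) : g.nrm x ≤ g.jap x :=
  Real.sqrt_le_sqrt (by linarith)

lemma jap_le_one_add (x : Fin d → ℝ) : g.jap x ≤ 1 + g.nrm x := by
  rw [jap, ← nrm_sq]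
  exact Real.sqrt_le_iff.2 ⟨by linarith [g.nrm_nonneg x], by nlinarith [g.nrm_nonneg x]⟩

lemma jap_le_jap_add_nrm_sub (x y : Fin d → ℝ) : g.jap x ≤ g.jap y + g.nrm (x - y) := by
  have hx : g.jap x ^ 2 = 1 + g.nrm x ^ 2 := by
    rw [nrm_sq, jap, Real.sq_sqrt]
    linarith [g.inn_self_nonneg x]
  have hy : g.jap y ^ 2 = 1 + g.nrm y ^ 2 := by
    rw [nrm_sq, jap, Real.sq_sqrt]
    linarith [g.inn_self_nonneg y]
  have h : g.nrm x ≤ g.nrm y + g.nrm (x - y) := by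
    simpa using g.nrm_add_le y (x - y)
  refine abs_le_of_sq_le_sq' ?_ (add_nonneg (g.jap_pos y).le (g.nrm_nonneg _)) |>.2
  rw [hx]
  nlinarith [g.nrm_nonneg x, g.nrm_nonneg y, g.nrm_nonneg (x - y), g.nrm_le_jap y,
    mul_le_mul_of_nonneg_right (g.nrm_le_jap y) (g.nrm_nonneg (x - y))]

/-- The form dominates the square of the sup norm. -/
lemma exists_mul_norm_le_nrm : ∃ c : ℝ, 0 < c ∧ ∀ x : Fin d → ℝ, c * ‖x‖ ≤ g.nrm x := by
  have hcont : Continuous g.nrm := by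
    have h : Continuous fun x : Fin d → ℝ => g.inn x x := by
      have hB : Continuous fun p : (Fin d → ℝ) × (Fin d → ℝ) => g.B p.1 p.2 := by
        have h1 : ∀ p : (Fin d → ℝ) × (Fin d → ℝ), g.B p.1 p.2 =
            ∑ i, p.1 i * g.B (Pi.single i 1) p.2 := by
          intro p
          conv_lhs => rw [pi_eq_sum_univ' p.1]
          simp [map_sum, LinearMap.sum_apply]
        simp_rw [h1]
        refine continuous_finsetSum _ fun i _ => Continuous.mul (by fun_prop) ?_
        exact (LinearMap.continuous_of_finiteDimensional (g.B (Pi.single i 1))).comp continuous_snd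
      exact hB.comp (continuous_id.prodMk continuous_id)
    exact Real.continuous_sqrt.comp h
  rcases (Metric.sphere (0 : Fin d → ℝ) 1).eq_empty_or_nonempty with he | hne
  · refine ⟨1, one_pos, fun x => ?_⟩
    by_cases hx : x = 0
    · simp [hx, nrm_zero]
    · exfalso
      have : ‖x‖⁻¹ • x ∈ Metric.sphere (0 : Fin d → ℝ) 1 := by
        simp [norm_smul, inv_mul_cancel₀ (norm_ne_zero_iff.2 hx)]
      simp [he] at this
  · obtain ⟨y, hy, hmin⟩ := (isCompact_sphere (0 : Fin d → ℝ) 1).exists_isMinOn hne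
      hcont.continuousOn
    have hy0 : y ≠ 0 := by
      rintro rfl
      simp at hy
    refine ⟨g.nrm y, Real.sqrt_pos.2 (g.posdef y hy0), fun x => ?_⟩
    by_cases hx : x = 0
    · simp [hx, nrm_zero]
    · have hn : 0 < ‖x‖ := norm_pos_iff.2 hx
      have hmem : ‖x‖⁻¹ • x ∈ Metric.sphere (0 : Fin d → ℝ) 1 := by
        simp [norm_smul, inv_mul_cancel₀ hn.ne']
      have h := isMinOn_iff.1 hmin _ hmem
      rw [nrm_smul, abs_of_pos (inv_pos.2 hn), inv_mul_eq_div, le_div_iff₀ hn] at h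
      exact h

/-- The sup norm dominates the norm of the form. -/
lemma exists_nrm_le_mul_norm : ∃ c : ℝ, 0 < c ∧ ∀ x : Fin d → ℝ, g.nrm x ≤ c * ‖x‖ := by
  refine ⟨∑ i, g.nrm (Pi.single i 1) + 1,
    add_pos_of_nonneg_of_pos (Finset.sum_nonneg fun i _ => g.nrm_nonneg _) one_pos, fun x => ?_⟩
  have hx : x = ∑ i, x i • (Pi.single i 1 : Fin d → ℝ) := by
    simpa using pi_eq_sum_univ' x
  calc g.nrm x = g.nrm (∑ i, x i • (Pi.single i 1 : Fin d → ℝ)) := by rw [← hx]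
    _ ≤ ∑ i, g.nrm (x i • (Pi.single i 1 : Fin d → ℝ)) := g.nrm_sum_le _ _
    _ ≤ ∑ i, ‖x‖ * g.nrm (Pi.single i 1) := by
        refine Finset.sum_le_sum fun i _ => ?_
        rw [nrm_smul]
        exact mul_le_mul_of_nonneg_right (norm_le_pi_norm x i) (g.nrm_nonneg _)
    _ ≤ (∑ i, g.nrm (Pi.single i 1) + 1) * ‖x‖ := by
        rw [← Finset.mul_sum]
        nlinarith [norm_nonneg x]

end PDForm

variable {d : ℕ}

lemma zc_zero : zc (0 : Fin d → ℤ) = 0 := by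
  ext i
  simp [zc]

lemma zc_add (k l : Fin d → ℤ) : zc (k + l) = zc k + zc l := by
  ext i
  simp [zc]

lemma zc_smul (n : ℤ) (k : Fin d → ℤ) : zc (n • k) = (n : ℝ) • zc k := by
  ext i
  simp [zc]

/-- The inclusion of `ℤ^d` into `ℝ^d` as a linear map. -/
def zcLin (d : ℕ) : (Fin d → ℤ) →ₗ[ℤ] (Fin d → ℝ) where
  toFun := zc
  map_add' := zc_add
  map_smul' n k := by
    rw [zc_smul]
    ext i
    simp

lemma zc_injective : Function.Injective (zc : (Fin d → ℤ) → Fin d → ℝ) := fun k l h => by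
  ext i
  have hi := congrFun h i
  simp only [zc] at hi
  exact_mod_cast hi

lemma zc_sub (k l : Fin d → ℤ) : zc (k - l) = zc k - zc l := map_sub (zcLin d) k l

lemma zc_sum {ι : Type*} (s : Finset ι) (f : ι → Fin d → ℤ) :
    zc (∑ i ∈ s, f i) = ∑ i ∈ s, zc (f i) := map_sum (zcLin d) f s

lemma one_le_norm_zc {k : Fin d → ℤ} (hk : k ≠ 0) : 1 ≤ ‖zc k‖ := by
  obtain ⟨i, hi⟩ := Function.ne_iff.1 hk
  refine le_trans ?_ (norm_le_pi_norm (zc k) i)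
  rw [Real.norm_eq_abs, zc]
  exact_mod_cast Int.one_le_abs hi

lemma frakc_pos (hd : 1 ≤ d) (g : PDForm d) : 0 < frakc g := by
  obtain ⟨c, hc, h⟩ := g.exists_mul_norm_le_nrm
  refine lt_of_lt_of_le (pow_pos hc 2) (le_csInf ?_ ?_)
  · refine ⟨_, fun _ => 1, ?_, rfl⟩
    exact Function.ne_iff.2 ⟨⟨0, hd⟩, by simp⟩
  · rintro _ ⟨k, hk, rfl⟩
    have := h (zc k)
    have h1 := one_le_norm_zc hk
    gcongr
    nlinarith

lemma sqrt_frakc_le (g : PDForm d) {k : Fin d → ℤ} (hk : k ≠ 0) :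
    √(frakc g) ≤ g.nrm (zc k) := by
  refine Real.sqrt_le_iff.2 ⟨g.nrm_nonneg _, csInf_le ⟨0, ?_⟩ ⟨k, hk, rfl⟩⟩
  rintro _ ⟨l, -, rfl⟩
  positivity

/-- Coefficients of a real combination of independent lattice vectors are controlled by its norm;
the proof is a simultaneous Dirichlet approximation of the ratios of the coefficients. -/
lemma abs_coeff_le (g : PDForm d) {μ K : ℝ} (hμ : 0 < μ)
    (hmin : ∀ k : Fin d → ℤ, k ≠ 0 → μ ≤ g.nrm (zc k)) {s : ℕ} (k : Fin s → Fin d → ℤ)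
    (hli : LinearIndependent ℝ fun j => zc (k j)) (hK : ∀ j, g.nrm (zc (k j)) ≤ K)
    (a : Fin s → ℝ) (i : Fin s) :
    |a i| ≤ 2 * ((2 * s + 1) * K / μ) ^ s / μ * g.nrm (∑ j, a j • zc (k j)) := by
  have hki : k i ≠ 0 := fun h => hli.ne_zero i (by simp [h, zc_zero])
  have hμK : μ ≤ K := (hmin _ hki).trans (hK i)
  have hK0 : 0 < K := hμ.trans_le hμK
  have hs : 0 < s := i.pos
  have hsR : (0 : ℝ) < s := by exact_mod_cast hs
  by_cases hai : a i = 0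
  · rw [hai, abs_zero]
    have := g.nrm_nonneg (∑ j, a j • zc (k j))
    positivity
  set t : Fin s → ℝ := fun j => a j / a i with ht
  set L : ℕ := ⌈2 * s * K / μ⌉₊ with hL
  have hLge : 2 * s * K / μ ≤ L := Nat.le_ceil _
  have hLle : (L : ℝ) ≤ (2 * s + 1) * K / μ := by
    have h1 : (L : ℝ) < 2 * s * K / μ + 1 := Nat.ceil_lt_add_one (by positivity)
    have h2 : (1 : ℝ) ≤ K / μ := (one_le_div hμ).2 hμK
    have h3 : (2 * s + 1) * K / μ = 2 * s * K / μ + K / μ := by ring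
    linarith
  have hL0 : (0 : ℝ) < L := lt_of_lt_of_le (by positivity) hLge
  have hLpos : 0 < L := by exact_mod_cast hL0
  let F : ℕ → Fin s → Fin L := fun n j =>
    ⟨⌊Int.fract (n * t j) * L⌋₊, by
      rw [Nat.floor_lt (mul_nonneg (Int.fract_nonneg _) hL0.le)]
      exact mul_lt_of_lt_one_left hL0 (Int.fract_lt_one _)⟩
  obtain ⟨n, hn, n', hn', hne, hF⟩ := Finset.exists_ne_map_eq_of_card_lt_of_maps_to
    (s := Finset.range (L ^ s + 1)) (t := (Finset.univ : Finset (Fin s → Fin L)))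
    (by simp) (f := F) (fun _ _ => Finset.mem_coe.2 (Finset.mem_univ _))
  set q : ℤ := (n : ℤ) - n' with hq
  have hq0 : q ≠ 0 := by
    simpa [hq, sub_eq_zero] using hne
  have hqle : |(q : ℝ)| ≤ (L : ℝ) ^ s := by
    have h1 : (n : ℝ) ≤ (L : ℝ) ^ s := by
      exact_mod_cast Nat.lt_succ_iff.1 (Finset.mem_range.1 hn)
    have h2 : (n' : ℝ) ≤ (L : ℝ) ^ s := by
      exact_mod_cast Nat.lt_succ_iff.1 (Finset.mem_range.1 hn')
    have h3 : (0 : ℝ) ≤ n := n.cast_nonneg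
    have h4 : (0 : ℝ) ≤ n' := n'.cast_nonneg
    rw [hq]
    push_cast
    rw [abs_le]
    constructor <;> linarith
  set p : Fin s → ℤ := fun j => ⌊n * t j⌋ - ⌊n' * t j⌋ with hp
  have happ : ∀ j, |q * t j - p j| ≤ 1 / L := by
    intro j
    have h1 : ⌊Int.fract (n * t j) * L⌋₊ = ⌊Int.fract (n' * t j) * L⌋₊ :=
      Fin.mk.inj_iff.1 (congrFun hF j)
    have hx : (0 : ℝ) ≤ Int.fract (n * t j) * L := mul_nonneg (Int.fract_nonneg _) hL0.le
    have hy : (0 : ℝ) ≤ Int.fract (n' * t j) * L := mul_nonneg (Int.fract_nonneg _) hL0.le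
    have e1 := Nat.floor_le hx
    have e2 := Nat.lt_floor_add_one (Int.fract (n * t j) * L)
    have e3 := Nat.floor_le hy
    have e4 := Nat.lt_floor_add_one (Int.fract (n' * t j) * L)
    rw [h1] at e1 e2
    have h2 : (q : ℝ) * t j - p j = Int.fract (n * t j) - Int.fract (n' * t j) := by
      simp only [hq, hp, Int.fract]
      push_cast
      ring
    rw [h2, le_div_iff₀ hL0, ← abs_of_pos hL0, ← abs_mul, abs_le]
    constructor <;> nlinarith
  have hpi : p i = q := by
    have : t i = 1 := div_self hai
    simp [hp, hq, this]
  set v : Fin d → ℤ := ∑ j, p j • k j with hv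
  have hzv : zc v = ∑ j, (p j : ℝ) • zc (k j) := by
    rw [hv, zc_sum]
    simp_rw [zc_smul]
  have hv0 : v ≠ 0 := by
    intro h0
    rw [h0, zc_zero] at hzv
    have := Fintype.linearIndependent_iff.1 hli _ hzv.symm i
    exact hq0 (by rw [← hpi]; exact_mod_cast this)
  set w := ∑ j, a j • zc (k j) with hw
  have hzv2 : zc v = ((q : ℝ) * (a i)⁻¹) • w - ∑ j, (q * t j - p j) • zc (k j) := by
    rw [hzv, hw, Finset.smul_sum, ← Finset.sum_sub_distrib]
    refine Finset.sum_congr rfl fun j _ => ?_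
    rw [smul_smul, ← sub_smul]
    congr 1
    simp only [ht]
    ring
  have hsum : g.nrm (∑ j, (q * t j - p j) • zc (k j)) ≤ μ / 2 := by
    calc g.nrm (∑ j, (q * t j - p j) • zc (k j))
        ≤ ∑ j : Fin s, g.nrm ((q * t j - p j) • zc (k j)) := g.nrm_sum_le _ _
      _ ≤ ∑ _j : Fin s, 1 / L * K := by
          refine Finset.sum_le_sum fun j _ => ?_
          rw [g.nrm_smul]
          exact mul_le_mul (happ j) (hK j) (g.nrm_nonneg _) (by positivity)
      _ = s * K / L := by
          simp
          ring
      _ ≤ μ / 2 := by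
          rw [div_le_iff₀ hμ] at hLge
          rw [div_le_div_iff₀ hL0 two_pos]
          linarith
  have hlow : μ / 2 ≤ (L : ℝ) ^ s * (|a i|⁻¹ * g.nrm w) := by
    have h1 := hmin v hv0
    have h2 := g.nrm_sub_le (((q : ℝ) * (a i)⁻¹) • w) (∑ j, (q * t j - p j) • zc (k j))
    rw [← hzv2, g.nrm_smul, abs_mul, abs_inv, mul_assoc] at h2
    have h3 : |(q : ℝ)| * (|a i|⁻¹ * g.nrm w) ≤ (L : ℝ) ^ s * (|a i|⁻¹ * g.nrm w) :=
      mul_le_mul_of_nonneg_right hqle (mul_nonneg (by positivity) (g.nrm_nonneg _))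
    linarith
  have hai' : 0 < |a i| := abs_pos.2 hai
  have hfin : |a i| ≤ 2 * (L : ℝ) ^ s / μ * g.nrm w := by
    rw [div_mul_eq_mul_div, le_div_iff₀ hμ]
    have h1 := mul_le_mul_of_nonneg_right hlow hai'.le
    have h2 : (L : ℝ) ^ s * (|a i|⁻¹ * g.nrm w) * |a i| = (L : ℝ) ^ s * g.nrm w := by
      field_simp
    linarith
  refine hfin.trans (mul_le_mul_of_nonneg_right ?_ (g.nrm_nonneg _))
  gcongr

/-- A vector almost orthogonal to independent lattice vectors is almost orthogonal to their span. -/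
lemma abs_inn_le_of_mem_span (g : PDForm d) {μ K A : ℝ} (hμ : 0 < μ)
    (hmin : ∀ k : Fin d → ℤ, k ≠ 0 → μ ≤ g.nrm (zc k)) {s : ℕ} (k : Fin s → Fin d → ℤ)
    (hli : LinearIndependent ℝ fun j => zc (k j)) (hK : ∀ j, g.nrm (zc (k j)) ≤ K)
    (x : Fin d → ℝ) (hA : ∀ j, |g.inn x (zc (k j))| ≤ A) (w : Fin d → ℝ)
    (hw : w ∈ Submodule.span ℝ (Set.range fun j => zc (k j))) :
    |g.inn x w| ≤ s * (2 * ((2 * s + 1) * K / μ) ^ s / μ) * A * g.nrm w := by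
  obtain ⟨a, rfl⟩ := (Submodule.mem_span_range_iff_exists_fun ℝ).1 hw
  have h : g.inn x (∑ j, a j • zc (k j)) = ∑ j, a j * g.inn x (zc (k j)) := by
    simp [PDForm.inn, map_sum]
  rw [h]
  calc |∑ j, a j * g.inn x (zc (k j))| ≤ ∑ j, |a j * g.inn x (zc (k j))| :=
        Finset.abs_sum_le_sum_abs _ _
    _ ≤ ∑ _j : Fin s, 2 * ((2 * s + 1) * K / μ) ^ s / μ * g.nrm (∑ j, a j • zc (k j)) * A := by
        refine Finset.sum_le_sum fun j _ => ?_
        rw [abs_mul]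
        have hb := abs_coeff_le g hμ hmin k hli hK a j
        exact mul_le_mul hb (hA j) (abs_nonneg _) ((abs_nonneg _).trans hb)
    _ = _ := by
        rw [Finset.sum_const, Finset.card_univ, Fintype.card_fin, nsmul_eq_mul]
        ring

/-- The saturated submodule generated by a family of lattice vectors. -/
def satSpan {ι : Type*} (k : ι → Fin d → ℤ) : Submodule ℤ (Fin d → ℤ) :=
  ((Submodule.span ℝ (Set.range fun j => zc (k j))).restrictScalars ℤ).comap (zcLin d)

lemma mem_satSpan {ι : Type*} {k : ι → Fin d → ℤ} {m : Fin d → ℤ} :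
    m ∈ satSpan k ↔ zc m ∈ Submodule.span ℝ (Set.range fun j => zc (k j)) := Iff.rfl

lemma self_mem_satSpan {ι : Type*} (k : ι → Fin d → ℤ) (j : ι) : k j ∈ satSpan k :=
  mem_satSpan.2 (Submodule.subset_span ⟨j, rfl⟩)

lemma isSat_satSpan {ι : Type*} (k : ι → Fin d → ℤ) : IsSat (satSpan k) := fun m hm => by
  rw [mem_satSpan]
  refine Submodule.span_le.2 ?_ hm
  rintro _ ⟨l, hl, rfl⟩
  exact hl

lemma card_le_zrank {M : Submodule ℤ (Fin d → ℤ)} {s : ℕ} {k : Fin s → Fin d → ℤ}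
    (hli : LinearIndependent ℝ fun j => zc (k j)) (hk : ∀ j, k j ∈ M) : s ≤ zrank M := by
  have h1 : LinearIndependent ℤ fun j => zc (k j) := hli.restrict_scalars' ℤ
  have h2 : LinearIndependent ℤ k := LinearIndependent.of_comp (zcLin d) h1
  have h3 : LinearIndependent ℤ fun j => (⟨k j, hk j⟩ : M) :=
    LinearIndependent.of_comp M.subtype h2
  simpa [zrank] using h3.fintype_card_le_finrank

lemma zrank_le (M : Submodule ℤ (Fin d → ℤ)) : zrank M ≤ d := by
  simpa [zrank] using Submodule.finrank_le M

lemma zrank_satSpan {s : ℕ} {k : Fin s → Fin d → ℤ}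
    (hli : LinearIndependent ℝ fun j => zc (k j)) : zrank (satSpan k) = s := by
  refine le_antisymm ?_ (card_le_zrank hli (self_mem_satSpan k))
  set S : Set (Fin d → ℝ) := zc '' (satSpan k : Set (Fin d → ℤ)) with hS
  have hspan : Submodule.span ℤ S = (satSpan k).map (zcLin d) := by
    rw [← Submodule.span_eq ((satSpan k).map (zcLin d))]
    rfl
  have hle : Submodule.span ℤ S ≤ Submodule.span ℤ (Set.range (Pi.basisFun ℝ (Fin d))) := by
    rw [hspan]
    rintro _ ⟨m, -, rfl⟩
    rw [(Pi.basisFun ℝ (Fin d)).mem_span_iff_repr_mem ℤ]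
    intro i
    exact ⟨m i, by simp [zcLin, zc]⟩
  have hdisc : DiscreteTopology (Submodule.span ℤ S) :=
    DiscreteTopology.of_subset (t := (Submodule.span ℤ S : Set (Fin d → ℝ)))
      (inferInstanceAs (DiscreteTopology
        (Submodule.span ℤ (Set.range (Pi.basisFun ℝ (Fin d)))))) hle
  have h1 : zrank (satSpan k) = Set.finrank ℤ S := by
    rw [Set.finrank, hspan, zrank]
    exact (LinearEquiv.finrank_eq (Submodule.equivMapOfInjective (zcLin d) zc_injective _))
  rw [h1, ← Real.finrank_eq_int_finrank_of_discrete hdisc, Set.finrank]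
  have h2 : Submodule.span ℝ S ≤ Submodule.span ℝ (Set.range fun j => zc (k j)) := by
    rw [Submodule.span_le]
    rintro _ ⟨m, hm, rfl⟩
    exact hm
  refine (Submodule.finrank_mono h2).trans ?_
  simpa [Set.finrank] using finrank_range_le_card (R := ℝ) fun j => zc (k j)

lemma linearIndependent_snoc {s : ℕ} {k : Fin s → Fin d → ℤ}
    (hli : LinearIndependent ℝ fun j => zc (k j)) {m : Fin d → ℤ}
    (hm : zc m ∉ Submodule.span ℝ (Set.range fun j => zc (k j))) :
    LinearIndependent ℝ fun j => zc ((Fin.snoc k m : Fin (s + 1) → Fin d → ℤ) j) := by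
  have h : (fun j => zc ((Fin.snoc k m : Fin (s + 1) → Fin d → ℤ) j)) =
      Fin.snoc (fun j => zc (k j)) (zc m) := Fin.comp_snoc zc k m
  rw [h]
  exact linearIndependent_finSnoc.2 ⟨hli, hm⟩

lemma zc_mem_span_of_mem {M : Submodule ℤ (Fin d → ℤ)} {s : ℕ} (hM : zrank M = s)
    {k : Fin s → Fin d → ℤ} (hli : LinearIndependent ℝ fun j => zc (k j)) (hk : ∀ j, k j ∈ M)
    {m : Fin d → ℤ} (hm : m ∈ M) : zc m ∈ Submodule.span ℝ (Set.range fun j => zc (k j)) := by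
  by_contra hnot
  have h := card_le_zrank (M := M) (linearIndependent_snoc hli hnot) (fun j => by
    refine Fin.lastCases ?_ (fun j => ?_) j
    · simpa using hm
    · simpa using hk j)
  omega

lemma IsSat.mem_of_mem_span {M : Submodule ℤ (Fin d → ℤ)} (hM : IsSat M) {s : ℕ}
    {k : Fin s → Fin d → ℤ} (hk : ∀ j, k j ∈ M) {m : Fin d → ℤ}
    (hm : zc m ∈ Submodule.span ℝ (Set.range fun j => zc (k j))) : m ∈ M := by
  refine hM m (Submodule.span_mono ?_ hm)
  rintro _ ⟨j, rfl⟩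
  exact ⟨k j, hk j, rfl⟩

/-- Distinct saturated submodules of the same rank are told apart by any independent family. -/
lemma exists_notMem_of_ne {M M' : Submodule ℤ (Fin d → ℤ)} {s : ℕ} (hM : IsSat M)
    (hM' : IsSat M') (hr : zrank M = s) (hr' : zrank M' = s) (hne : M ≠ M')
    {k : Fin s → Fin d → ℤ} (hli : LinearIndependent ℝ fun j => zc (k j))
    (hk : ∀ j, k j ∈ M') : ∃ j, k j ∉ M := by
  by_contra! hall
  refine hne (le_antisymm (fun m hm => ?_) fun m hm => ?_)
  · exact hM'.mem_of_mem_span hk (zc_mem_span_of_mem hr hli hall hm)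
  · exact hM.mem_of_mem_span hall (zc_mem_span_of_mem hr' hli hk hm)

/-- A sublinear perturbation changes quantities bounded below by one by a bounded factor. -/
lemma exists_le_mul_of_le_add_rpow {p : ℝ} (hp : p < 1) {C : ℝ} (hC : 0 ≤ C) :
    ∃ G : ℝ, 1 ≤ G ∧ ∀ X Y : ℝ, 1 ≤ X → 1 ≤ Y → Y ≤ X + C * (X ^ p + Y ^ p) → Y ≤ G * X := by
  have hq : 0 < 1 - p := by linarith
  set Y₀ : ℝ := (2 * C) ^ (1 / (1 - p)) with hY₀
  have hY₀n : 0 ≤ Y₀ := by positivity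
  refine ⟨2 * (1 + C) + Y₀, by linarith, fun X Y hX hY h => ?_⟩
  have hXp : X ^ p ≤ X := by
    simpa using Real.rpow_le_rpow_of_exponent_le hX hp.le
  rcases le_total Y Y₀ with hle | hle
  · nlinarith
  · have h1 : 2 * C ≤ Y ^ (1 - p) := by
      have h2 := Real.rpow_le_rpow hY₀n hle hq.le
      rwa [hY₀, ← Real.rpow_mul (by positivity), one_div_mul_cancel hq.ne', Real.rpow_one] at h2
    have h3 : Y ^ (1 - p) * Y ^ p = Y := by
      rw [← Real.rpow_add (by linarith)]
      simp
    have h4 : 0 < Y ^ p := Real.rpow_pos_of_pos (by linarith) _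
    have h5 : 2 * C * Y ^ p ≤ Y := by
      calc 2 * C * Y ^ p ≤ Y ^ (1 - p) * Y ^ p := mul_le_mul_of_nonneg_right h1 h4.le
        _ = Y := h3
    have h6 : C * X ^ p ≤ C * X := mul_le_mul_of_nonneg_left hXp hC
    nlinarith

/-- The resonance conditions on an independent family bound the pairing with its span. -/
lemma exists_abs_inn_le_of_resonant {μ C D τ : ℝ} (hμ : 0 < μ) (hC : 1 ≤ C) (hD : 1 ≤ D)
    (hτ : 0 ≤ τ) (q ε : ℝ) (s : ℕ) :
    ∃ A : ℝ, 0 ≤ A ∧ ∀ g : PDForm d, (∀ k : Fin d → ℤ, k ≠ 0 → μ ≤ g.nrm (zc k)) →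
      ∀ (k : Fin s → Fin d → ℤ) (x : Fin d → ℝ), LinearIndependent ℝ (fun j => zc (k j)) →
      (∀ j, |g.inn x (zc (k j))| ≤ C * g.jap x ^ q * g.nrm (zc (k j)) ^ (-τ)) →
      (∀ j, g.nrm (zc (k j)) ≤ D * g.jap x ^ ε) →
      ∀ w ∈ Submodule.span ℝ (Set.range fun j => zc (k j)),
        |g.inn x w| ≤ A * g.jap x ^ (q + s * ε) * g.nrm w := by
  refine ⟨s * (2 * ((2 * s + 1) * D / μ) ^ s / μ) * (C * μ ^ (-τ)), by positivity, ?_⟩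
  intro g hmin k x hli hres hnrm w hw
  have hX := g.jap_pos x
  have hA : ∀ j, |g.inn x (zc (k j))| ≤ C * g.jap x ^ q * μ ^ (-τ) := fun j => by
    have hkj : k j ≠ 0 := fun h => hli.ne_zero j (by simp [h, zc_zero])
    refine (hres j).trans (mul_le_mul_of_nonneg_left ?_ (by positivity))
    exact Real.rpow_le_rpow_of_nonpos hμ (hmin _ hkj) (by linarith)
  refine (abs_inn_le_of_mem_span g hμ hmin k hli hnrm x hA w hw).trans_eq ?_
  have h1 : g.jap x ^ (q + s * ε) = g.jap x ^ q * (g.jap x ^ ε) ^ s := by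
    rw [Real.rpow_add hX, mul_comm (s : ℝ), Real.rpow_mul hX.le, Real.rpow_natCast]
  have h2 : ((2 * s + 1) * (D * g.jap x ^ ε) / μ) ^ s =
      ((2 * s + 1) * D / μ) ^ s * (g.jap x ^ ε) ^ s := by
    rw [← mul_pow]
    congr 1
    ring
  rw [h1, h2]
  ring

set_option maxHeartbeats 1000000 in
/-- Moving along a resonant direction `m`, a further resonance `k` persists with worse constants. -/
lemma exists_resonance_transfer {p q ε τ C D A : ℝ} (hε : 0 < ε) (hεp : ε ≤ p) (hp : p < 1)
    (hqp : q ≤ p) (hτ : 0 ≤ τ) (hC : 1 ≤ C) (hD : 1 ≤ D) (hA : 0 ≤ A) :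
    ∃ C' D' : ℝ, ∀ (g : PDForm d) (x y y' m k₀ l₀ k₀' k : Fin d → ℝ),
      y = x + m + (1 / 2 : ℝ) • (l₀ - k₀) → y' = x + m + (1 / 2 : ℝ) • (k₀' - k₀) →
      |g.inn x m| ≤ A * g.jap x ^ p * g.nrm m → |g.inn y m| ≤ A * g.jap y ^ p * g.nrm m →
      g.nrm k₀ ≤ D * g.jap x ^ ε → g.nrm l₀ ≤ D * g.jap y ^ ε →
      g.nrm k₀' ≤ D * g.jap y' ^ ε → g.nrm k ≤ D * g.jap y' ^ ε → 0 < g.nrm k →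
      |g.inn y' k| ≤ C * g.jap y' ^ q * g.nrm k ^ (-τ) →
      |g.inn x k| ≤ C' * g.jap x ^ (p + (τ + 1) * ε) * g.nrm k ^ (-τ) ∧
        g.nrm k ≤ D' * g.jap x ^ ε := by
  obtain ⟨G₁, hG₁, hG₁'⟩ := exists_le_mul_of_le_add_rpow hp (C := A + 2 * D) (by positivity)
  obtain ⟨G₂, hG₂, hG₂'⟩ := exists_le_mul_of_le_add_rpow hp (C := D) (by positivity)
  set G := G₂ * G₁ with hG
  have hG1 : 1 ≤ G := one_le_mul_of_one_le_of_one_le hG₂ hG₁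
  have hG₁G : G₁ ≤ G := le_mul_of_one_le_left (by linarith) hG₂
  refine ⟨C * G + ((A + D) * (1 + G) + D * (1 + G)) * (D * G) ^ (τ + 1), D * G, ?_⟩
  intro g x y y' m k₀ l₀ k₀' k hy hy' hxm hym hk₀ hl₀ hk₀' hk hkpos hres
  have hX1 := g.one_le_jap x
  have hY1 := g.one_le_jap y
  have hY'1 := g.one_le_jap y'
  set X := g.jap x
  set Y := g.jap y
  set Y' := g.jap y'
  have hX0 : 0 < X := by linarith
  have hXp : X ^ ε ≤ X ^ p := Real.rpow_le_rpow_of_exponent_le hX1 hεp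
  have hYp : Y ^ ε ≤ Y ^ p := Real.rpow_le_rpow_of_exponent_le hY1 hεp
  have hY'p : Y' ^ ε ≤ Y' ^ p := Real.rpow_le_rpow_of_exponent_le hY'1 hεp
  have hXp0 : 0 < X ^ p := by positivity
  have hYp0 : 0 < Y ^ p := by positivity
  have hY'p0 : 0 < Y' ^ p := by positivity
  have hk₀p : g.nrm k₀ ≤ D * X ^ p := hk₀.trans (by gcongr)
  have hl₀p : g.nrm l₀ ≤ D * Y ^ p := hl₀.trans (by gcongr)
  have hk₀'p : g.nrm k₀' ≤ D * Y' ^ p := hk₀'.trans (by gcongr)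
  have hm : g.nrm m ≤ (A + D) * (X ^ p + Y ^ p) := by
    have h1 : g.nrm m ^ 2 = g.inn y m - g.inn x m - 1 / 2 * (g.inn l₀ m - g.inn k₀ m) := by
      rw [g.nrm_sq, hy]
      simp only [PDForm.inn, map_add, map_smul, map_sub, LinearMap.add_apply, LinearMap.smul_apply,
        LinearMap.sub_apply, smul_eq_mul]
      ring
    have h2 := abs_le.1 (g.abs_inn_le l₀ m)
    have h3 := abs_le.1 (g.abs_inn_le k₀ m)
    have h4 := abs_le.1 hxm
    have h5 := abs_le.1 hym
    rcases (g.nrm_nonneg m).eq_or_lt with h0 | h0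
    · rw [← h0]
      positivity
    · refine le_of_mul_le_mul_right ?_ h0
      have h6 := mul_le_mul_of_nonneg_right hl₀p h0.le
      have h7 := mul_le_mul_of_nonneg_right hk₀p h0.le
      have h8 : 0 ≤ D * (X ^ p + Y ^ p) * g.nrm m := by positivity
      nlinarith
  have hhalf : ∀ u v : Fin d → ℝ, g.nrm ((1 / 2 : ℝ) • (u - v)) ≤ g.nrm u + g.nrm v := by
    intro u v
    rw [g.nrm_smul, abs_of_pos (by norm_num)]
    linarith [g.nrm_sub_le u v, g.nrm_nonneg u, g.nrm_nonneg v]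
  have hYX : Y ≤ G₁ * X := by
    refine hG₁' X Y hX1 hY1 ((g.jap_le_jap_add_nrm_sub y x).trans ?_)
    have h1 : y - x = m + (1 / 2 : ℝ) • (l₀ - k₀) := by
      rw [hy]
      abel
    have h2 := g.nrm_add_le m ((1 / 2 : ℝ) • (l₀ - k₀))
    rw [← h1] at h2
    linarith [hhalf l₀ k₀]
  have hY'Y : Y' ≤ G₂ * Y := by
    refine hG₂' Y Y' hY1 hY'1 ((g.jap_le_jap_add_nrm_sub y' y).trans ?_)
    have h1 : y' - y = (1 / 2 : ℝ) • (k₀' - l₀) := by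
      rw [hy, hy', smul_sub, smul_sub, smul_sub]
      abel
    rw [h1]
    linarith [hhalf k₀' l₀]
  have hY'X : Y' ≤ G * X := by
    calc Y' ≤ G₂ * Y := hY'Y
      _ ≤ G₂ * (G₁ * X) := by gcongr
      _ = G * X := by ring
  have hpow : ∀ V r : ℝ, 1 ≤ V → V ≤ G * X → 0 ≤ r → r ≤ 1 → V ^ r ≤ G * X ^ r := by
    intro V r hV hVX hr hr1
    calc V ^ r ≤ (G * X) ^ r := Real.rpow_le_rpow (by linarith) hVX hr
      _ = G ^ r * X ^ r := Real.mul_rpow (by linarith) hX0.le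
      _ ≤ G * X ^ r := by
          gcongr
          simpa using Real.rpow_le_rpow_of_exponent_le hG1 hr1
  have hYpX : Y ^ p ≤ G * X ^ p :=
    hpow Y p hY1 (hYX.trans (by gcongr)) (by linarith) hp.le
  have hY'pX : Y' ^ p ≤ G * X ^ p := hpow Y' p hY'1 hY'X (by linarith) hp.le
  have hkX : g.nrm k ≤ D * G * X ^ ε := by
    have := hpow Y' ε hY'1 hY'X hε.le (by linarith)
    calc g.nrm k ≤ D * Y' ^ ε := hk
      _ ≤ D * (G * X ^ ε) := by gcongr
      _ = D * G * X ^ ε := by ring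
  refine ⟨?_, hkX⟩
  have hdist : g.nrm (y' - x) ≤ ((A + D) * (1 + G) + D * (1 + G)) * X ^ p := by
    have h1 : y' - x = m + (1 / 2 : ℝ) • (k₀' - k₀) := by
      rw [hy']
      abel
    have h2 := g.nrm_add_le m ((1 / 2 : ℝ) • (k₀' - k₀))
    rw [← h1] at h2
    have h3 : (A + D) * (X ^ p + Y ^ p) ≤ (A + D) * (X ^ p + G * X ^ p) := by gcongr
    have h4 : D * Y' ^ p ≤ D * (G * X ^ p) := by gcongr
    linarith [hhalf k₀' k₀]
  have hnk : 0 < g.nrm k ^ (-τ) := Real.rpow_pos_of_pos hkpos _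
  have hsplit : g.nrm k = g.nrm k ^ (τ + 1) * g.nrm k ^ (-τ) := by
    rw [← Real.rpow_add hkpos]
    simp
  have hkpow : g.nrm k ^ (τ + 1) ≤ (D * G) ^ (τ + 1) * X ^ ((τ + 1) * ε) := by
    calc g.nrm k ^ (τ + 1) ≤ (D * G * X ^ ε) ^ (τ + 1) :=
          Real.rpow_le_rpow hkpos.le hkX (by linarith)
      _ = (D * G) ^ (τ + 1) * X ^ ((τ + 1) * ε) := by
          rw [Real.mul_rpow (by positivity) (by positivity), ← Real.rpow_mul hX0.le,
            mul_comm ε]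
  have hfirst : |g.inn y' k| ≤ C * G * X ^ (p + (τ + 1) * ε) * g.nrm k ^ (-τ) := by
    refine hres.trans (mul_le_mul_of_nonneg_right ?_ hnk.le)
    have h1 : Y' ^ q ≤ Y' ^ p := Real.rpow_le_rpow_of_exponent_le hY'1 hqp
    have h2 : X ^ p ≤ X ^ (p + (τ + 1) * ε) :=
      Real.rpow_le_rpow_of_exponent_le hX1 (by nlinarith)
    calc C * Y' ^ q ≤ C * (G * X ^ p) := by gcongr; exact h1.trans hY'pX
      _ ≤ C * (G * X ^ (p + (τ + 1) * ε)) := by gcongr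
      _ = _ := by ring
  have hsecond : |g.inn (y' - x) k| ≤ ((A + D) * (1 + G) + D * (1 + G)) * (D * G) ^ (τ + 1) *
      X ^ (p + (τ + 1) * ε) * g.nrm k ^ (-τ) := by
    calc |g.inn (y' - x) k| ≤ g.nrm (y' - x) * g.nrm k := g.abs_inn_le _ _
      _ = g.nrm (y' - x) * g.nrm k ^ (τ + 1) * g.nrm k ^ (-τ) := by
          rw [mul_assoc, ← hsplit]
      _ ≤ ((A + D) * (1 + G) + D * (1 + G)) * X ^ p * ((D * G) ^ (τ + 1) * X ^ ((τ + 1) * ε)) *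
          g.nrm k ^ (-τ) := by
          gcongr
      _ = _ := by
          rw [Real.rpow_add hX0]
          ring
  have hxk : g.inn x k = g.inn y' k - g.inn (y' - x) k := by
    simp [PDForm.inn]
  rw [hxk]
  refine (abs_sub _ _).trans ?_
  linarith

/-- Lattice points in a ball are counted by their residues modulo a large integer. -/
lemma finite_and_card_le_of_nrm_add_le (g : PDForm d) {μ R : ℝ} (hμ : 0 < μ)
    (hmin : ∀ k : Fin d → ℤ, k ≠ 0 → μ ≤ g.nrm (zc k)) (κ : Fin d → ℝ)
    (S : Set (Fin d → ℤ)) (hS : ∀ ξ ∈ S, g.nrm (zc ξ + κ) ≤ R) :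
    S.Finite ∧ Nat.card S ≤ (⌊2 * R / μ⌋₊ + 1) ^ d := by
  set N : ℕ := ⌊2 * R / μ⌋₊ + 1 with hN
  have hNR : 2 * R < N * μ := by
    rw [← div_lt_iff₀ hμ, hN]
    exact_mod_cast Nat.lt_floor_add_one (2 * R / μ)
  have : NeZero N := ⟨by omega⟩
  let F : S → Fin d → ZMod N := fun ξ i => ((ξ : Fin d → ℤ) i : ZMod N)
  have hF : Function.Injective F := by
    rintro ⟨ξ, hξ⟩ ⟨η, hη⟩ h
    have hdvd : ∀ i, ∃ c, η i - ξ i = N * c := fun i =>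
      (ZMod.intCast_eq_intCast_iff_dvd_sub _ _ _).1 (congrFun h i)
    choose v hv using hdvd
    have hv' : η - ξ = (N : ℤ) • v := by
      ext i
      simpa using hv i
    have hnrm : g.nrm (zc (η - ξ)) ≤ 2 * R := by
      have h1 : zc (η - ξ) = (zc η + κ) - (zc ξ + κ) := by
        rw [zc_sub]
        abel
      rw [h1]
      linarith [g.nrm_sub_le (zc η + κ) (zc ξ + κ), hS ξ hξ, hS η hη]
    have hv0 : v = 0 := by
      by_contra hne
      rw [hv', zc_smul, g.nrm_smul] at hnrm
      have h2 := hmin v hne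
      have h3 : |((N : ℤ) : ℝ)| = N := by simp
      rw [h3] at hnrm
      have : (N : ℝ) * μ ≤ N * g.nrm (zc v) := by gcongr
      linarith
    rw [hv0, smul_zero, sub_eq_zero] at hv'
    simp [hv']
  have hfin : Finite S := Finite.of_injective F hF
  refine ⟨hfin, ?_⟩
  simpa using Nat.card_le_card_of_injective F hF

lemma xik_eq (κ : Fin d → ℝ) (ξ k : Fin d → ℤ) :
    xik κ ξ k = zc ξ + κ + (1 / 2 : ℝ) • zc k := by
  ext i
  simp only [xik, zc, Pi.add_apply, Pi.smul_apply, smul_eq_mul]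
  ring

/-- The passage from the constants `C`, `D` of level `n` to the constants `C'`, `D'` of level
`n + 1`: a resonance that holds at a point joined to `x` along the resonant span holds at `x`. -/
def ResonanceTransfer (d : ℕ) (δ ε τ μ : ℝ) (n : ℕ) (C D C' D' : ℝ) : Prop :=
  ∀ g : PDForm d, (∀ k : Fin d → ℤ, k ≠ 0 → μ ≤ g.nrm (zc k)) →
  ∀ (k l : Fin (n + 1) → Fin d → ℤ) (x y y' m k₀' v : Fin d → ℝ),
    LinearIndependent ℝ (fun j => zc (k j)) → LinearIndependent ℝ (fun j => zc (l j)) →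
    y = x + m + (1 / 2 : ℝ) • (zc (l 0) - zc (k 0)) →
    y' = x + m + (1 / 2 : ℝ) • (k₀' - zc (k 0)) →
    m ∈ Submodule.span ℝ (Set.range fun j => zc (k j)) →
    m ∈ Submodule.span ℝ (Set.range fun j => zc (l j)) →
    (∀ j, |g.inn x (zc (k j))| ≤
      C * g.jap x ^ (δ + n * ((d + τ + 1) * ε)) * g.nrm (zc (k j)) ^ (-τ)) →
    (∀ j, g.nrm (zc (k j)) ≤ D * g.jap x ^ ε) →
    (∀ j, |g.inn y (zc (l j))| ≤
      C * g.jap y ^ (δ + n * ((d + τ + 1) * ε)) * g.nrm (zc (l j)) ^ (-τ)) →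
    (∀ j, g.nrm (zc (l j)) ≤ D * g.jap y ^ ε) →
    g.nrm k₀' ≤ D * g.jap y' ^ ε → g.nrm v ≤ D * g.jap y' ^ ε → 0 < g.nrm v →
    |g.inn y' v| ≤ C * g.jap y' ^ (δ + n * ((d + τ + 1) * ε)) * g.nrm v ^ (-τ) →
    |g.inn x v| ≤
        C' * g.jap x ^ (δ + (n + 1 : ℕ) * ((d + τ + 1) * ε)) * g.nrm v ^ (-τ) ∧
      g.nrm v ≤ D' * g.jap x ^ ε

lemma ParamsOK.tau_nonneg {δ ε τ : ℝ} (h : ParamsOK d δ ε τ) : 0 ≤ τ := by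
  obtain ⟨hd, -, -, -, hτ, -⟩ := h
  have : (1 : ℝ) ≤ d := by exact_mod_cast hd
  linarith

lemma ParamsOK.exponent_lt_one {δ ε τ : ℝ} (h : ParamsOK d δ ε τ) {n : ℕ} (hn : n < d) :
    δ + n * ((d + τ + 1) * ε) + (n + 1 : ℕ) * ε < 1 := by
  have hτ := h.tau_nonneg
  obtain ⟨-, -, -, hε, -, hlt, -⟩ := h
  have h1 : (n : ℝ) + 1 ≤ d := by exact_mod_cast hn
  have h2 : (0 : ℝ) ≤ d := d.cast_nonneg
  have h3 : ((n : ℝ) + 1) * ((d + τ + 1) * ε) ≤ d * ((d + τ + 1) * ε) := by gcongr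
  have h4 : ((n : ℝ) + 1) * ε ≤ (d + τ + 1) * ε := by
    gcongr
    linarith
  push_cast
  linarith

lemma ResonanceTransfer.exists_constants {δ ε τ : ℝ} (hpar : ParamsOK d δ ε τ) {μ : ℝ}
    (hμ : 0 < μ) (n : ℕ) {C D : ℝ} (hC : 1 ≤ C) (hD : 1 ≤ D) :
    ∃ C' D' : ℝ, C < C' ∧ D < D' ∧ (n + 1 < d → ResonanceTransfer d δ ε τ μ n C D C' D') := by
  by_cases hn : n + 1 < d
  swap
  · exact ⟨C + 1, D + 1, by linarith, by linarith, fun h => absurd h hn⟩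
  have hτ := hpar.tau_nonneg
  have hlt := hpar.exponent_lt_one (Nat.lt_of_succ_lt hn)
  obtain ⟨-, hδ, -, hε, -, -, -⟩ := hpar
  set q := δ + n * ((d + τ + 1) * ε) with hq
  have hq0 : 0 ≤ q := by positivity
  have hnε : 0 ≤ (n : ℝ) * ε := by positivity
  obtain ⟨A, hA, hspan⟩ := exists_abs_inn_le_of_resonant (d := d) hμ hC hD hτ q ε (n + 1)
  obtain ⟨C₁, D₁, htr⟩ := exists_resonance_transfer (d := d) (p := q + (n + 1 : ℕ) * ε) (q := q)
    hε (by push_cast; linarith) hlt (by push_cast; linarith) hτ hC hD hA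
  refine ⟨max C₁ (C + 1), max D₁ (D + 1), lt_max_of_lt_right (by linarith),
    lt_max_of_lt_right (by linarith), fun _ => ?_⟩
  intro g hmin k l x y y' m k₀' v hk hl hy hy' hmk hml hxk hkn hyl hln hk₀' hvn hv hyv
  obtain ⟨h1, h2⟩ := htr g x y y' m (zc (k 0)) (zc (l 0)) k₀' v hy hy'
    (hspan g hmin k x hk hxk hkn m hmk) (hspan g hmin l y hl hyl hln m hml) (hkn 0) (hln 0)
    hk₀' hvn hv hyv
  have hX0 := g.jap_pos x
  have hv0 : 0 < g.nrm v ^ (-τ) := Real.rpow_pos_of_pos hv _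
  refine ⟨h1.trans (mul_le_mul_of_nonneg_right ?_ hv0.le), h2.trans ?_⟩
  · refine mul_le_mul (le_max_left _ _)
      (Real.rpow_le_rpow_of_exponent_le (g.one_le_jap x) ?_) (by positivity)
      (le_max_of_le_right (by linarith))
    have h4 : (n : ℝ) + 1 + 1 ≤ d := by exact_mod_cast hn
    have h5 : ((n : ℝ) + 1) * ε ≤ d * ε := by
      gcongr
      linarith
    rw [hq]
    push_cast
    linarith
  · gcongr
    exact le_max_left _ _

lemma exists_resonance_constants {δ ε τ : ℝ} (hpar : ParamsOK d δ ε τ) {μ : ℝ} (hμ : 0 < μ) :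
    ∃ Cs Ds : ℕ → ℝ, Cs 0 = 1 ∧ Ds 0 = 1 ∧ StrictMono Cs ∧ StrictMono Ds ∧
      ∀ n, n + 1 < d →
        ResonanceTransfer d δ ε τ μ n (Cs n) (Ds n) (Cs (n + 1)) (Ds (n + 1)) := by
  have step : ∀ (n : ℕ) (P : {P : ℝ × ℝ // 1 ≤ P.1 ∧ 1 ≤ P.2}),
      ∃ Q : {P : ℝ × ℝ // 1 ≤ P.1 ∧ 1 ≤ P.2}, P.1.1 < Q.1.1 ∧ P.1.2 < Q.1.2 ∧
        (n + 1 < d → ResonanceTransfer d δ ε τ μ n P.1.1 P.1.2 Q.1.1 Q.1.2) := by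
    rintro n ⟨⟨C, D⟩, hC, hD⟩
    obtain ⟨C', D', h1, h2, h3⟩ := ResonanceTransfer.exists_constants hpar hμ n hC hD
    exact ⟨⟨(C', D'), hC.trans h1.le, hD.trans h2.le⟩, h1, h2, h3⟩
  choose F hF using step
  let f : ℕ → {P : ℝ × ℝ // 1 ≤ P.1 ∧ 1 ≤ P.2} :=
    fun n => Nat.rec ⟨(1, 1), le_rfl, le_rfl⟩ (fun n P => F n P) n
  exact ⟨fun n => (f n).1.1, fun n => (f n).1.2, rfl, rfl,
    strictMono_nat_of_lt_succ fun n => (hF n (f n)).1,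
    strictMono_nat_of_lt_succ fun n => (hF n (f n)).2.1, fun n => (hF n (f n)).2.2⟩

namespace ZoneData

variable {Z : ZoneData d}

/-- The resonance conditions defining `Z_{k₁,…,k_s}`, with the constants of the last vector. -/
lemma exists_of_mem_ZM (hpar : ParamsOK d Z.δ Z.ε Z.τ) (hC : StrictMono Z.Cs) (hC0 : Z.Cs 0 = 1)
    (hD : StrictMono Z.Ds) {n : ℕ} {M : Submodule ℤ (Fin d → ℤ)} {ξ : Fin d → ℤ}
    (hξ : ξ ∈ Z.ZM (n + 1) M) :
    ∃ k : Fin (n + 1) → Fin d → ℤ, (∀ j, k j ∈ M) ∧ LinearIndependent ℝ (fun j => zc (k j)) ∧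
      (∀ j : Fin (n + 1),
        |Z.g.inn (xik Z.κ ξ (k 0)) (zc (k j))| ≤
          Z.Cs j * Z.g.jap (xik Z.κ ξ (k 0)) ^ Z.δs j * Z.g.nrm (zc (k j)) ^ (-Z.τ) ∧
        Z.g.nrm (zc (k j)) ≤ Z.Ds j * Z.g.jap (xik Z.κ ξ (k 0)) ^ Z.ε) ∧
      (∀ j : Fin (n + 1), |Z.g.inn (xik Z.κ ξ (k 0)) (zc (k j))| ≤
        Z.Cs n * Z.g.jap (xik Z.κ ξ (k 0)) ^ (Z.δ + n * ((d + Z.τ + 1) * Z.ε)) *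
          Z.g.nrm (zc (k j)) ^ (-Z.τ)) ∧
      ∀ j : Fin (n + 1), Z.g.nrm (zc (k j)) ≤ Z.Ds n * Z.g.jap (xik Z.κ ξ (k 0)) ^ Z.ε := by
  obtain ⟨-, hs, k, hkM, hli, hk⟩ := hξ
  have hτ := hpar.tau_nonneg
  have hε : 0 < Z.ε := hpar.2.2.2.1
  refine ⟨k, hkM, hli, hk, fun j => (hk j).1.trans ?_, fun j => (hk j).2.trans ?_⟩
  · have hjn : (j : ℕ) ≤ n := Nat.lt_succ_iff.1 j.2
    have hX := Z.g.one_le_jap (xik Z.κ ξ (k 0))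
    have hCj : 0 ≤ Z.Cs n := by
      have := hC.monotone (Nat.zero_le n)
      linarith
    refine mul_le_mul_of_nonneg_right ?_ (Real.rpow_nonneg (Z.g.nrm_nonneg _) _)
    refine mul_le_mul (hC.monotone hjn) (Real.rpow_le_rpow_of_exponent_le hX ?_)
      (Real.rpow_nonneg (Z.g.jap_pos _).le _) hCj
    rw [δs]
    gcongr
  · exact mul_le_mul_of_nonneg_right (hD.monotone (Nat.lt_succ_iff.1 j.2))
      (Real.rpow_nonneg (Z.g.jap_pos _).le _)

lemma mem_E_of_mem_ZM {s : ℕ} {M : Submodule ℤ (Fin d → ℤ)} {ξ : Fin d → ℤ}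
    (hξ : ξ ∈ Z.ZM s M) : ξ ∈ Z.E := hξ.1

lemma mem_EM_iff {s : ℕ} {M : Submodule ℤ (Fin d → ℤ)} {ξ : Fin d → ℤ} :
    ξ ∈ Z.EM s M ↔ (∃ b ∈ Z.BM s M, ∃ m ∈ M, ξ = b + m) ∧ ξ ∈ Z.ZM s M ∧
      ∀ r, 1 ≤ r → r < s → ∀ M' : Submodule ℤ (Fin d → ℤ),
        IsSat M' → zrank M' = r → ξ ∉ Z.EM r M' := by
  rw [EM]
  rfl

lemma notMem_Z0_of_mem_ZM (hC0 : Z.Cs 0 = 1) (hD0 : Z.Ds 0 = 1) {s : ℕ}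
    {M : Submodule ℤ (Fin d → ℤ)} {ξ : Fin d → ℤ} (hξ : ξ ∈ Z.ZM s M) : ξ ∉ Z.Z0 := by
  obtain ⟨-, hs, k, -, hli, hk⟩ := hξ
  intro h0
  have hk0 : k ⟨0, hs⟩ ≠ 0 := fun h => hli.ne_zero ⟨0, hs⟩ (by simp [h, zc_zero])
  obtain ⟨h1, h2⟩ := hk ⟨0, hs⟩
  simp only [hC0, hD0, δs, Nat.cast_zero, zero_mul, add_zero, one_mul] at h1 h2
  exact absurd h1 (not_le.2 (h0.2 _ hk0 h2))

lemma exists_mem_ZM_of_notMem_Z0 (hC0 : Z.Cs 0 = 1) (hD0 : Z.Ds 0 = 1) {ξ : Fin d → ℤ}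
    (hE : ξ ∈ Z.E) (hξ : ξ ∉ Z.Z0) :
    ∃ M : Submodule ℤ (Fin d → ℤ), IsSat M ∧ zrank M = 1 ∧ ξ ∈ Z.ZM 1 M := by
  have h : ∃ k : Fin d → ℤ, k ≠ 0 ∧ Z.g.nrm (zc k) ≤ Z.g.jap (xik Z.κ ξ k) ^ Z.ε ∧
      |Z.g.inn (xik Z.κ ξ k) (zc k)| ≤
        Z.g.jap (xik Z.κ ξ k) ^ Z.δ * Z.g.nrm (zc k) ^ (-Z.τ) := by
    by_contra! hno
    exact hξ ⟨hE, hno⟩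
  obtain ⟨k, hk0, h1, h2⟩ := h
  have hli : LinearIndependent ℝ fun j : Fin 1 => zc ((fun _ => k : Fin 1 → Fin d → ℤ) j) := by
    refine linearIndependent_unique_iff.2 fun h => hk0 (zc_injective ?_)
    rw [zc_zero]
    exact h
  refine ⟨satSpan (fun _ : Fin 1 => k), isSat_satSpan _, zrank_satSpan hli, hE, one_pos,
    fun _ => k, self_mem_satSpan _, hli, fun j => ?_⟩
  have hj : (j : ℕ) = 0 := by omega
  simpa [hj, hC0, hD0, δs] using And.intro h2 h1

lemma union_eq (hC0 : Z.Cs 0 = 1) (hD0 : Z.Ds 0 = 1) :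
    (Z.Z0 ∪ ⋃ (s : ℕ) (M : Submodule ℤ (Fin d → ℤ))
      (_ : 1 ≤ s ∧ s ≤ d ∧ IsSat M ∧ zrank M = s), Z.EM s M) = Z.E := by
  classical
  ext ξ
  simp only [Set.mem_union, Set.mem_iUnion, exists_prop]
  constructor
  · rintro (h | ⟨s, M, -, h⟩)
    · exact h.1
    · exact mem_E_of_mem_ZM (mem_EM_iff.1 h).2.1
  · intro hE
    by_cases h0 : ξ ∈ Z.Z0
    · exact Or.inl h0
    right
    let P : ℕ → Prop := fun s => ∃ M : Submodule ℤ (Fin d → ℤ),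
      IsSat M ∧ zrank M = s ∧ ξ ∈ Z.ZM s M
    have hP1 : P 1 := exists_mem_ZM_of_notMem_Z0 hC0 hD0 hE h0
    have hPd : ∀ s, P s → s ≤ d := by
      rintro s ⟨M, -, rfl, -⟩
      exact zrank_le M
    set s := Nat.findGreatest P d with hs
    obtain ⟨M, hM, hr, hξM⟩ : P s := Nat.findGreatest_spec (hPd 1 hP1) hP1
    have hs1 : 1 ≤ s := Nat.le_findGreatest (hPd 1 hP1) hP1
    have hnot : ∀ M' : Submodule ℤ (Fin d → ℤ), IsSat M' ∧ zrank M' = s + 1 →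
        ξ ∉ Z.ZM (s + 1) M' := fun M' hM' hmem =>
      Nat.findGreatest_is_greatest (Nat.lt_succ_self s) (hPd _ ⟨M', hM'.1, hM'.2, hmem⟩)
        ⟨M', hM'.1, hM'.2, hmem⟩
    have hB : ξ ∈ Z.BM s M := ⟨hξM, by simpa using fun M' h h' => hnot M' ⟨h, h'⟩⟩
    by_cases hprev : ∀ r, 1 ≤ r → r < s → ∀ M' : Submodule ℤ (Fin d → ℤ),
        IsSat M' → zrank M' = r → ξ ∉ Z.EM r M'
    · exact ⟨s, M, ⟨hs1, hPd s ⟨M, hM, hr, hξM⟩, hM, hr⟩,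
        mem_EM_iff.2 ⟨⟨ξ, hB, 0, M.zero_mem, by simp⟩, hξM, hprev⟩⟩
    · push Not at hprev
      obtain ⟨r, hr1, -, M', hM', hrM', hmem⟩ := hprev
      exact ⟨r, M', ⟨hr1, hrM' ▸ zrank_le M', hM', hrM'⟩, hmem⟩

/-- Extended blocks of the same dimension attached to different submodules do not meet. -/
lemma disjoint_EM_of_ne (hpar : ParamsOK d Z.δ Z.ε Z.τ) {μ : ℝ} (hμ : 0 < μ)
    (hmin : ∀ k : Fin d → ℤ, k ≠ 0 → μ ≤ Z.g.nrm (zc k))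
    (hC0 : Z.Cs 0 = 1) (hC : StrictMono Z.Cs) (hD : StrictMono Z.Ds)
    (htr : ∀ n, n + 1 < d → ResonanceTransfer d Z.δ Z.ε Z.τ μ n
      (Z.Cs n) (Z.Ds n) (Z.Cs (n + 1)) (Z.Ds (n + 1)))
    {s : ℕ} (hs : 1 ≤ s) {M M' : Submodule ℤ (Fin d → ℤ)} (hM : IsSat M) (hr : zrank M = s)
    (hM' : IsSat M') (hr' : zrank M' = s) (hne : M ≠ M') :
    Disjoint (Z.EM s M) (Z.EM s M') := by
  rw [Set.disjoint_left]
  intro ξ hξ hξ'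
  obtain ⟨n, rfl⟩ : ∃ n, s = n + 1 := ⟨s - 1, by omega⟩
  obtain ⟨⟨b, ⟨hbZ, hbnot⟩, m, hm, rfl⟩, hξZ, -⟩ := mem_EM_iff.1 hξ
  have hξZ' := (mem_EM_iff.1 hξ').2.1
  obtain ⟨k, hkM, hkli, hkorig, hkC, hkD⟩ := exists_of_mem_ZM hpar hC hC0 hD hbZ
  obtain ⟨l, hlM, hlli, -, hlC, hlD⟩ := exists_of_mem_ZM hpar hC hC0 hD hξZ
  obtain ⟨k', hk'M, hk'li, -, hk'C, hk'D⟩ := exists_of_mem_ZM hpar hC hC0 hD hξZ'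
  obtain ⟨j, hj⟩ := exists_notMem_of_ne hM hM' hr hr' hne hk'li hk'M
  have hsnoc := linearIndependent_snoc hkli (m := k' j) fun h => hj (hM.mem_of_mem_span hkM h)
  have hnd : n + 1 < d := by
    have := hsnoc.fintype_card_le_finrank
    simpa using this
  have hk'j : k' j ≠ 0 := fun h => hj (h ▸ M.zero_mem)
  obtain ⟨h1, h2⟩ := htr n hnd Z.g hmin k l (xik Z.κ b (k 0)) (xik Z.κ (b + m) (l 0))
    (xik Z.κ (b + m) (k' 0)) (zc m) (zc (k' 0)) (zc (k' j)) hkli hlli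
    (by rw [xik_eq, xik_eq, zc_add, smul_sub]; abel)
    (by rw [xik_eq, xik_eq, zc_add, smul_sub]; abel)
    (zc_mem_span_of_mem hr hkli hkM hm) (zc_mem_span_of_mem hr hlli hlM hm)
    hkC hkD hlC hlD (hk'D 0) (hk'D j) (hμ.trans_le (hmin _ hk'j)) (hk'C j)
  refine hbnot (Set.mem_iUnion₂.2 ⟨satSpan (Fin.snoc k (k' j) : Fin (n + 1 + 1) → Fin d → ℤ),
    ⟨isSat_satSpan _, zrank_satSpan hsnoc⟩, hbZ.1, Nat.succ_pos _, Fin.snoc k (k' j),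
    self_mem_satSpan _, hsnoc, fun i => ?_⟩)
  have hzero : (Fin.snoc k (k' j) : Fin (n + 1 + 1) → Fin d → ℤ) ⟨0, Nat.succ_pos _⟩ = k 0 :=
    Fin.snoc_castSucc (α := fun _ => Fin d → ℤ) (k' j) k 0
  rw [hzero]
  refine Fin.lastCases ?_ (fun i => ?_) i
  · simpa only [Fin.snoc_last, Fin.val_last, δs] using And.intro h1 h2
  · simpa only [Fin.snoc_castSucc, Fin.val_castSucc] using hkorig i

end ZoneData

/-- The fully resonant zone is contained in a ball of controlled radius around `-κ`. -/
lemma exists_nrm_le_of_mem_ZM_top {δ ε τ : ℝ} (hpar : ParamsOK d δ ε τ) {μ : ℝ} (hμ : 0 < μ)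
    {Cs Ds : ℕ → ℝ} (hC0 : Cs 0 = 1) (hD0 : Ds 0 = 1) (hC : StrictMono Cs) (hD : StrictMono Ds) :
    ∃ R : ℝ, ∀ (g : PDForm d) (κ : Fin d → ℝ) (E : Set (Fin d → ℤ)),
      (∀ k : Fin d → ℤ, k ≠ 0 → μ ≤ g.nrm (zc k)) →
      ∀ ξ ∈ (⟨g, κ, E, δ, ε, τ, Cs, Ds⟩ : ZoneData d).ZM d ⊤, g.nrm (zc ξ + κ) ≤ R := by
  obtain ⟨n, rfl⟩ : ∃ n, d = n + 1 := ⟨d - 1, by have := hpar.1; omega⟩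
  have hlt := hpar.exponent_lt_one (Nat.lt_succ_self n)
  set q := δ + n * (((n + 1 : ℕ) + τ + 1) * ε) with hq
  have hCn : 1 ≤ Cs n := hC0 ▸ hC.monotone (Nat.zero_le n)
  have hDn : 1 ≤ Ds n := hD0 ▸ hD.monotone (Nat.zero_le n)
  obtain ⟨A, hA, hspan⟩ := exists_abs_inn_le_of_resonant (d := n + 1) hμ hCn hDn
    hpar.tau_nonneg q ε (n + 1)
  obtain ⟨G, hG1, hG⟩ := exists_le_mul_of_le_add_rpow hlt hA
  refine ⟨G + Ds n * G ^ ε, fun g κ E hmin ξ hξ => ?_⟩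
  obtain ⟨k, -, hkli, -, hkC, hkD⟩ := ZoneData.exists_of_mem_ZM hpar hC hC0 hD hξ
  simp only at hkC hkD
  set x := xik κ ξ (k 0) with hx
  have htop : Submodule.span ℝ (Set.range fun j => zc (k j)) = ⊤ :=
    hkli.span_eq_top_of_card_eq_finrank' (by simp)
  have h1 := hspan g hmin k x hkli hkC hkD x (by rw [htop]; trivial)
  have hX := g.one_le_jap x
  have hXp : 0 < g.jap x ^ (q + (n + 1 : ℕ) * ε) := Real.rpow_pos_of_pos (g.jap_pos x) _
  have h2 : g.nrm x ≤ A * g.jap x ^ (q + (n + 1 : ℕ) * ε) := by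
    rw [← g.nrm_sq, abs_of_nonneg (sq_nonneg _), sq] at h1
    rcases (g.nrm_nonneg x).eq_or_lt with h0 | h0
    · rw [← h0]
      positivity
    · exact le_of_mul_le_mul_right h1 h0
  have h3 : g.jap x ≤ G := by
    have := hG 1 (g.jap x) le_rfl hX (by
      rw [Real.one_rpow]
      linarith [g.jap_le_one_add x])
    linarith
  have h4 : zc ξ + κ = x - (1 / 2 : ℝ) • zc (k 0) := by
    rw [hx, xik_eq]
    abel
  have h5 : g.jap x ^ ε ≤ G ^ ε := Real.rpow_le_rpow (by linarith) h3 hpar.2.2.2.1.le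
  have h6 : Ds n * g.jap x ^ ε ≤ Ds n * G ^ ε := by gcongr
  rw [h4]
  refine (g.nrm_sub_le _ _).trans ?_
  rw [g.nrm_smul, abs_of_pos (by norm_num)]
  linarith [g.nrm_le_jap x, hkD 0, g.nrm_nonneg (zc (k 0))]

/-- The integer points of the cube of half-side `A`. -/
noncomputable def intCube (d A : ℕ) : Finset (Fin d → ℤ) := Fintype.piFinset fun _ => Finset.Icc (-(A : ℤ)) A

lemma mem_intCube {A : ℕ} {ξ : Fin d → ℤ} : ξ ∈ intCube d A ↔ ∀ i, |ξ i| ≤ A := by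
  simp [intCube, abs_le]

lemma card_intCube (d A : ℕ) : (intCube d A).card = (2 * A + 1) ^ d := by
  simp only [intCube, Fintype.card_piFinset, Int.card_Icc, Finset.prod_const, Finset.card_univ,
    Fintype.card_fin]
  congr 1
  omega

lemma mem_intCube_of_norm_le {A : ℕ} {ξ : Fin d → ℤ} (h : ‖zc ξ‖ ≤ A) : ξ ∈ intCube d A := by
  refine mem_intCube.2 fun i => ?_
  have h1 := (norm_le_pi_norm (zc ξ) i).trans h
  rw [Real.norm_eq_abs, zc] at h1
  exact_mod_cast h1

lemma norm_le_of_mem_intCube {A : ℕ} {ξ : Fin d → ℤ} (h : ξ ∈ intCube d A) : ‖zc ξ‖ ≤ A := by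
  refine (pi_norm_le_iff_of_nonneg A.cast_nonneg).2 fun i => ?_
  rw [Real.norm_eq_abs, zc]
  exact_mod_cast mem_intCube.1 h i

/-- Lattice points of a cube lying in a strip orthogonal to `k`. -/
lemma card_strip_le (g : PDForm d) {η : ℝ} (hη : 0 < η) (k : Fin d → ℤ) (i : Fin d)
    (hi : η ≤ |g.inn (Pi.single i 1) (zc k)|) (u : Fin d → ℝ) (A B : ℕ)
    (T : Finset (Fin d → ℤ))
    (hT : ∀ ξ ∈ T, ξ ∈ intCube d A ∧ |g.inn (zc ξ + u) (zc k)| ≤ B * η) :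
    T.card ≤ (2 * A + 1) ^ (d - 1) * (2 * B + 1) := by
  classical
  let F : (Fin d → ℤ) → Fin d → ℤ := fun ξ =>
    Function.update ξ i ⌊g.inn (zc ξ + u) (zc k) / η⌋
  let box : Fin d → Finset ℤ := Function.update (fun _ => Finset.Icc (-(A : ℤ)) A) i
    (Finset.Icc (-(B : ℤ)) B)
  have hcard : (Fintype.piFinset box).card = (2 * A + 1) ^ (d - 1) * (2 * B + 1) := by
    have h1 : ∀ j, (box j).card = Function.update (fun _ => 2 * A + 1) i (2 * B + 1) j := by
      intro j
      by_cases hj : j = i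
      · subst hj
        simp only [box, Function.update_self, Int.card_Icc]
        omega
      · simp only [box, Function.update_of_ne hj, Int.card_Icc]
        omega
    rw [Fintype.card_piFinset, Finset.prod_congr rfl fun j _ => h1 j,
      Finset.prod_update_of_mem (Finset.mem_univ i), mul_comm]
    simp [Finset.card_sdiff]
  rw [← hcard]
  refine Finset.card_le_card_of_injOn F (fun ξ hξ => ?_) fun ξ hξ ξ' hξ' h => ?_
  · obtain ⟨h1, h2⟩ := hT ξ hξ
    refine Finset.mem_coe.2 (Fintype.mem_piFinset.2 fun j => ?_)
    by_cases hj : j = i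
    · subst hj
      have h3 : |g.inn (zc ξ + u) (zc k) / η| ≤ B := by
        rw [abs_div, abs_of_pos hη]
        exact (div_le_iff₀ hη).2 h2
      obtain ⟨h4, h5⟩ := abs_le.1 h3
      simp only [F, box, Function.update_self, Finset.mem_Icc]
      refine ⟨Int.le_floor.2 (by push_cast; exact h4), ?_⟩
      exact_mod_cast (Int.floor_le _).trans h5
    · simp only [F, box, Function.update_of_ne hj, Finset.mem_Icc]
      exact abs_le.1 (mem_intCube.1 h1 j)
  · have hoff : ∀ j, j ≠ i → ξ j = ξ' j := fun j hj => by
      simpa [F, hj] using congrFun h j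
    have hfl : ⌊g.inn (zc ξ + u) (zc k) / η⌋ = ⌊g.inn (zc ξ' + u) (zc k) / η⌋ := by
      simpa [F] using congrFun h i
    have hdiff : zc ξ - zc ξ' = ((ξ i - ξ' i : ℤ) : ℝ) • (Pi.single i 1 : Fin d → ℝ) := by
      ext j
      by_cases hj : j = i
      · subst hj
        simp [zc]
      · simp [zc, hoff j hj, hj]
    have hinn : g.inn (zc ξ + u) (zc k) / η - g.inn (zc ξ' + u) (zc k) / η =
        ((ξ i - ξ' i : ℤ) : ℝ) * g.inn (Pi.single i 1) (zc k) / η := by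
      rw [← sub_div]
      congr 1
      have h3 : g.inn (zc ξ + u) (zc k) - g.inn (zc ξ' + u) (zc k) =
          g.inn (zc ξ - zc ξ') (zc k) := by
        simp [PDForm.inn]
      rw [h3, hdiff]
      simp [PDForm.inn]
    have hlt := Int.abs_sub_lt_one_of_floor_eq_floor hfl
    rw [hinn, abs_div, abs_mul, abs_of_pos hη, div_lt_one hη] at hlt
    have hzero : ξ i - ξ' i = 0 := by
      by_contra hne
      have h4 : (1 : ℝ) ≤ |((ξ i - ξ' i : ℤ) : ℝ)| := by exact_mod_cast Int.one_le_abs hne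
      nlinarith [abs_nonneg (g.inn (Pi.single i 1) (zc k))]
    ext j
    by_cases hj : j = i
    · subst hj
      omega
    · exact hoff j hj

lemma exists_le_abs_inn_single (hd : 1 ≤ d) (g : PDForm d) {c : ℝ} (hc : 0 < c)
    (hnrm : ∀ x : Fin d → ℝ, c * ‖x‖ ≤ g.nrm x) {k : Fin d → ℤ} (hk : k ≠ 0) :
    ∃ i, c ^ 2 / d ≤ |g.inn (Pi.single i 1) (zc k)| := by
  by_contra! hall
  have hne : (Finset.univ : Finset (Fin d)).Nonempty := ⟨⟨0, hd⟩, Finset.mem_univ _⟩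
  have hd0 : (0 : ℝ) < d := by exact_mod_cast hd
  have h1 := one_le_norm_zc hk
  have hexp : g.nrm (zc k) ^ 2 = ∑ i, zc k i * g.inn (Pi.single i 1) (zc k) := by
    rw [g.nrm_sq]
    refine (congrArg (fun v => g.B v (zc k)) (pi_eq_sum_univ' (zc k))).trans ?_
    simp [PDForm.inn, map_sum, LinearMap.sum_apply]
  have hlt : g.nrm (zc k) ^ 2 < ∑ _i : Fin d, ‖zc k‖ * (c ^ 2 / d) := by
    rw [hexp]
    refine Finset.sum_lt_sum_of_nonempty hne fun i _ => ?_
    calc zc k i * g.inn (Pi.single i 1) (zc k)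
        ≤ |zc k i| * |g.inn (Pi.single i 1) (zc k)| := by
          rw [← abs_mul]
          exact le_abs_self _
      _ ≤ ‖zc k‖ * |g.inn (Pi.single i 1) (zc k)| := by
          gcongr
          exact norm_le_pi_norm (zc k) i
      _ < ‖zc k‖ * (c ^ 2 / d) := mul_lt_mul_of_pos_left (hall i) (by linarith)
  have h2 : ∑ _i : Fin d, ‖zc k‖ * (c ^ 2 / d) = c ^ 2 * ‖zc k‖ := by
    simp
    field_simp
  have h3 : (c * ‖zc k‖) ^ 2 ≤ g.nrm (zc k) ^ 2 := by
    have := hnrm (zc k)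
    gcongr
  rw [h2] at hlt
  have h4 : c ^ 2 * ‖zc k‖ ≤ (c * ‖zc k‖) ^ 2 := by
    rw [mul_pow]
    have : ‖zc k‖ ≤ ‖zc k‖ ^ 2 := by nlinarith
    gcongr
  linarith

lemma two_mul_ceil_add_one_le {a r : ℝ} (ha : 0 ≤ a) (hr : 1 ≤ r) :
    2 * (⌈a * r⌉₊ : ℝ) + 1 ≤ (2 * a + 3) * r := by
  have := Nat.ceil_lt_add_one (a := a * r) (by positivity)
  nlinarith

namespace ZoneData

/-- The resonant lattice points of a ball of radius `R` number `O(R^(d-1+δ+dε))`. -/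
lemma exists_ncard_resonant_le (Z : ZoneData d) (hpar : ParamsOK d Z.δ Z.ε Z.τ)
    (hE : Z.E = Set.univ) :
    ∃ Q : ℝ, ∀ R : ℝ, 1 ≤ R →
      (Set.ncard {ξ : Fin d → ℤ | ξ ∉ Z.Z0 ∧ Z.g.nrm (zc ξ) ≤ R} : ℝ) ≤
        Q * ((R ^ Z.ε) ^ d * (R ^ (d - 1) * R ^ Z.δ)) := by
  classical
  have hτ := hpar.tau_nonneg
  obtain ⟨hd, hδ, hδ1, hε, -, hlt, -⟩ := hpar
  have hd1 : (1 : ℝ) ≤ d := by exact_mod_cast hd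
  have hε1 : Z.ε ≤ 1 := by
    have h1 : 1 * (1 * Z.ε) ≤ (d : ℝ) * ((d + Z.τ + 1) * Z.ε) := by
      gcongr
      linarith
    linarith
  obtain ⟨c, hc, hcn⟩ := Z.g.exists_mul_norm_le_nrm
  set η : ℝ := c ^ 2 / d with hηdef
  have hη : 0 < η := by positivity
  set c₁ : ℝ := 2 * (2 + Z.g.nrm Z.κ) with hc₁
  have hc₁1 : 1 ≤ c₁ := by linarith [Z.g.nrm_nonneg Z.κ]
  set w : ℝ := c₁ * c ^ (-Z.τ) / η with hw
  have hw0 : 0 ≤ w := by positivity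
  refine ⟨(2 * (c₁ / c) + 3) ^ d * ((2 * c⁻¹ + 3) ^ (d - 1) * (2 * w + 3)), fun R hR => ?_⟩
  have hR0 : 0 < R := by linarith
  set A : ℕ := ⌈c⁻¹ * R⌉₊ with hA
  set K : ℕ := ⌈c₁ / c * R ^ Z.ε⌉₊ with hK
  set B : ℕ := ⌈w * R ^ Z.δ⌉₊ with hB
  have hkmin : ∀ k : Fin d → ℤ, k ≠ 0 → c ≤ Z.g.nrm (zc k) := fun k hk => by
    have := hcn (zc k)
    have := one_le_norm_zc hk
    nlinarith
  let T : (Fin d → ℤ) → Finset (Fin d → ℤ) := fun k => (intCube d A).filter fun ξ =>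
    |Z.g.inn (zc ξ + (Z.κ + (1 / 2 : ℝ) • zc k)) (zc k)| ≤ B * η
  let U : Finset (Fin d → ℤ) := ((intCube d K).filter fun k => k ≠ 0).biUnion T
  have hsub : {ξ : Fin d → ℤ | ξ ∉ Z.Z0 ∧ Z.g.nrm (zc ξ) ≤ R} ⊆ (U : Set (Fin d → ℤ)) := by
    rintro ξ ⟨hξ, hξR⟩
    have h : ∃ k : Fin d → ℤ, k ≠ 0 ∧ Z.g.nrm (zc k) ≤ Z.g.jap (xik Z.κ ξ k) ^ Z.ε ∧
        |Z.g.inn (xik Z.κ ξ k) (zc k)| ≤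
          Z.g.jap (xik Z.κ ξ k) ^ Z.δ * Z.g.nrm (zc k) ^ (-Z.τ) := by
      by_contra! hno
      exact hξ ⟨hE ▸ Set.mem_univ ξ, hno⟩
    obtain ⟨k, hk0, hk1, hk2⟩ := h
    have hX1 := Z.g.one_le_jap (xik Z.κ ξ k)
    set X := Z.g.jap (xik Z.κ ξ k) with hX
    have hXε : X ^ Z.ε ≤ X := by
      simpa using Real.rpow_le_rpow_of_exponent_le hX1 hε1
    have hXR : X ≤ c₁ * R := by
      have h1 := Z.g.jap_le_one_add (xik Z.κ ξ k)
      rw [← hX, xik_eq] at h1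
      have h2 := Z.g.nrm_add_le (zc ξ + Z.κ) ((1 / 2 : ℝ) • zc k)
      have h3 := Z.g.nrm_add_le (zc ξ) Z.κ
      rw [Z.g.nrm_smul, abs_of_pos (by norm_num)] at h2
      have h4 := Z.g.nrm_nonneg Z.κ
      nlinarith
    have hpow : ∀ r : ℝ, 0 ≤ r → r ≤ 1 → X ^ r ≤ c₁ * R ^ r := fun r hr hr1 => by
      calc X ^ r ≤ (c₁ * R) ^ r := Real.rpow_le_rpow (by linarith) hXR hr
        _ = c₁ ^ r * R ^ r := Real.mul_rpow (by linarith) hR0.le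
        _ ≤ c₁ * R ^ r := by
            gcongr
            simpa using Real.rpow_le_rpow_of_exponent_le hc₁1 hr1
    refine Finset.mem_coe.2 (Finset.mem_biUnion.2 ⟨k, ?_, ?_⟩)
    · refine Finset.mem_filter.2 ⟨mem_intCube_of_norm_le ?_, hk0⟩
      refine le_trans ?_ (Nat.le_ceil _)
      rw [div_mul_eq_mul_div, le_div_iff₀ hc, mul_comm]
      exact (hcn _).trans (hk1.trans (hpow _ hε.le hε1))
    · refine Finset.mem_filter.2 ⟨mem_intCube_of_norm_le ?_, ?_⟩
      · refine le_trans ?_ (Nat.le_ceil _)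
        rw [inv_mul_eq_div, le_div_iff₀ hc, mul_comm]
        exact (hcn _).trans hξR
      · rw [← add_assoc, ← xik_eq]
        refine hk2.trans ?_
        have h5 : w * R ^ Z.δ * η ≤ B * η :=
          mul_le_mul_of_nonneg_right (Nat.le_ceil _) hη.le
        refine le_trans ?_ h5
        have h6 : w * R ^ Z.δ * η = c₁ * R ^ Z.δ * c ^ (-Z.τ) := by
          rw [hw]
          field_simp
        rw [h6]
        exact mul_le_mul (hpow _ hδ.le hδ1.le)
          (Real.rpow_le_rpow_of_nonpos hc (hkmin k hk0) (by linarith))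
          (Real.rpow_nonneg (Z.g.nrm_nonneg _) _) (by positivity)
  have hUcard : U.card ≤ (2 * K + 1) ^ d * ((2 * A + 1) ^ (d - 1) * (2 * B + 1)) := by
    refine (Finset.card_biUnion_le_card_mul _ _
      ((2 * A + 1) ^ (d - 1) * (2 * B + 1)) fun k hk => ?_).trans
      (Nat.mul_le_mul_right _ ((Finset.card_filter_le _ _).trans_eq (card_intCube d K)))
    obtain ⟨i, hi⟩ := exists_le_abs_inn_single hd Z.g hc hcn (Finset.mem_filter.1 hk).2
    exact card_strip_le Z.g hη k i hi _ A B _ fun ξ hξ => Finset.mem_filter.1 hξ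
  have hncard : Set.ncard {ξ : Fin d → ℤ | ξ ∉ Z.Z0 ∧ Z.g.nrm (zc ξ) ≤ R} ≤ U.card := by
    rw [← Set.ncard_coe_finset]
    exact Set.ncard_le_ncard hsub U.finite_toSet
  have hRε : 1 ≤ R ^ Z.ε := Real.one_le_rpow hR hε.le
  have hRδ : 1 ≤ R ^ Z.δ := Real.one_le_rpow hR hδ.le
  have hKle : 2 * (K : ℝ) + 1 ≤ (2 * (c₁ / c) + 3) * R ^ Z.ε :=
    two_mul_ceil_add_one_le (by positivity) hRε
  have hAle : 2 * (A : ℝ) + 1 ≤ (2 * c⁻¹ + 3) * R := two_mul_ceil_add_one_le (by positivity) hR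
  have hBle : 2 * (B : ℝ) + 1 ≤ (2 * w + 3) * R ^ Z.δ := two_mul_ceil_add_one_le hw0 hRδ
  calc (Set.ncard {ξ : Fin d → ℤ | ξ ∉ Z.Z0 ∧ Z.g.nrm (zc ξ) ≤ R} : ℝ)
      ≤ (2 * (K : ℝ) + 1) ^ d * ((2 * (A : ℝ) + 1) ^ (d - 1) * (2 * (B : ℝ) + 1)) := by
        exact_mod_cast hncard.trans hUcard
    _ ≤ ((2 * (c₁ / c) + 3) * R ^ Z.ε) ^ d *
          (((2 * c⁻¹ + 3) * R) ^ (d - 1) * ((2 * w + 3) * R ^ Z.δ)) := by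
        gcongr
    _ = _ := by
        rw [mul_pow, mul_pow]
        ring

/-- The nonresonant zone has density one at infinity. -/
lemma tendsto_density (Z : ZoneData d) (hpar : ParamsOK d Z.δ Z.ε Z.τ) (hE : Z.E = Set.univ) :
    Filter.Tendsto (fun R : ℝ =>
      (Nat.card {ξ : Fin d → ℤ | ξ ∈ Z.Z0 ∧ Z.g.nrm (zc ξ) ≤ R} : ℝ) /
        (Nat.card {ξ : Fin d → ℤ | Z.g.nrm (zc ξ) ≤ R} : ℝ)) Filter.atTop (nhds 1) := by
  obtain ⟨Q, hQ⟩ := Z.exists_ncard_resonant_le hpar hE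
  have hτ := hpar.tau_nonneg
  obtain ⟨hd, hδ, hδ1, hε, -, hlt, -⟩ := hpar
  obtain ⟨c, hc, hcn⟩ := Z.g.exists_mul_norm_le_nrm
  obtain ⟨Λ, hΛ, hΛn⟩ := Z.g.exists_nrm_le_mul_norm
  set σ : ℝ := 1 - (Z.δ + d * Z.ε) with hσ
  have hσ0 : 0 < σ := by
    have h1 : (d : ℝ) * (1 * Z.ε) ≤ d * ((d + Z.τ + 1) * Z.ε) := by
      gcongr
      linarith [(d.cast_nonneg : (0 : ℝ) ≤ d)]
    linarith
  have hlim : Filter.Tendsto (fun R : ℝ => 1 - Q * Λ ^ d * R ^ (-σ)) Filter.atTop (nhds 1) := by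
    simpa using (tendsto_rpow_neg_atTop hσ0).const_mul (Q * Λ ^ d) |>.const_sub 1
  have hfacts : ∀ R : ℝ, 1 ≤ R →
      1 - Q * Λ ^ d * R ^ (-σ) ≤
        (Nat.card {ξ : Fin d → ℤ | ξ ∈ Z.Z0 ∧ Z.g.nrm (zc ξ) ≤ R} : ℝ) /
          (Nat.card {ξ : Fin d → ℤ | Z.g.nrm (zc ξ) ≤ R} : ℝ) ∧
      (Nat.card {ξ : Fin d → ℤ | ξ ∈ Z.Z0 ∧ Z.g.nrm (zc ξ) ≤ R} : ℝ) /
          (Nat.card {ξ : Fin d → ℤ | Z.g.nrm (zc ξ) ≤ R} : ℝ) ≤ 1 := by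
    intro R hR
    have hR0 : 0 < R := by linarith
    rw [Nat.card_coe_set_eq, Nat.card_coe_set_eq]
    set S := {ξ : Fin d → ℤ | Z.g.nrm (zc ξ) ≤ R} with hS
    have hSfin : S.Finite := by
      refine (intCube d ⌈R / c⌉₊).finite_toSet.subset fun ξ hξ => ?_
      refine Finset.mem_coe.2 (mem_intCube_of_norm_le (le_trans ?_ (Nat.le_ceil _)))
      rw [le_div_iff₀ hc, mul_comm]
      exact (hcn _).trans hξ
    have hgood : {ξ : Fin d → ℤ | ξ ∈ Z.Z0 ∧ Z.g.nrm (zc ξ) ≤ R} =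
        S \ {ξ : Fin d → ℤ | ξ ∉ Z.Z0 ∧ Z.g.nrm (zc ξ) ≤ R} := by
      ext ξ
      simp only [hS, Set.mem_ofPred_eq, Set.mem_sdiff]
      tauto
    have hbadsub : {ξ : Fin d → ℤ | ξ ∉ Z.Z0 ∧ Z.g.nrm (zc ξ) ≤ R} ⊆ S := fun ξ h => h.2
    have hbad := hQ R hR
    have hadd := Set.ncard_sdiff_add_ncard_of_subset hbadsub hSfin
    rw [← hgood] at hadd
    set good := {ξ : Fin d → ℤ | ξ ∈ Z.Z0 ∧ Z.g.nrm (zc ξ) ≤ R}.ncard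
    set bad := {ξ : Fin d → ℤ | ξ ∉ Z.Z0 ∧ Z.g.nrm (zc ξ) ≤ R}.ncard
    have haddR : (good : ℝ) + bad = S.ncard := by exact_mod_cast hadd
    have htot : (R / Λ) ^ d ≤ S.ncard := by
      have h1 : (intCube d ⌊R / Λ⌋₊ : Set (Fin d → ℤ)) ⊆ S := fun ξ hξ => by
        have h2 := norm_le_of_mem_intCube (Finset.mem_coe.1 hξ)
        have h3 : ‖zc ξ‖ ≤ R / Λ := h2.trans (Nat.floor_le (by positivity))
        rw [le_div_iff₀ hΛ, mul_comm] at h3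
        exact (hΛn _).trans h3
      have h2 := Set.ncard_le_ncard h1 hSfin
      rw [Set.ncard_coe_finset, card_intCube] at h2
      refine le_trans ?_ (by exact_mod_cast h2 :
        ((2 * (⌊R / Λ⌋₊ : ℝ) + 1) ^ d) ≤ (S.ncard : ℝ))
      have h3 := Nat.lt_floor_add_one (R / Λ)
      have h4 : (0 : ℝ) ≤ ⌊R / Λ⌋₊ := Nat.cast_nonneg _
      gcongr
      linarith
    have hpos : (0 : ℝ) < S.ncard := lt_of_lt_of_le (by positivity) htot
    have hpow : (R ^ Z.ε) ^ d * (R ^ (d - 1) * R ^ Z.δ) = R ^ d * R ^ (-σ) := by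
      rw [← Real.rpow_natCast (R ^ Z.ε), ← Real.rpow_mul hR0.le, ← Real.rpow_natCast R (d - 1),
        ← Real.rpow_natCast R d, ← Real.rpow_add hR0, ← Real.rpow_add hR0, ← Real.rpow_add hR0,
        Nat.cast_sub hd, hσ]
      congr 1
      push_cast
      ring
    rw [hpow] at hbad
    have hQ0 : 0 ≤ Q := by
      have h1 : 0 < R ^ d * R ^ (-σ) := by positivity
      have h2 : (0 : ℝ) ≤ bad := Nat.cast_nonneg _
      nlinarith
    constructor
    · rw [le_div_iff₀ hpos]
      have h1 : Q * (R ^ d * R ^ (-σ)) = Q * Λ ^ d * R ^ (-σ) * (R / Λ) ^ d := by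
        rw [div_pow]
        field_simp
      have h2 : Q * Λ ^ d * R ^ (-σ) * (R / Λ) ^ d ≤ Q * Λ ^ d * R ^ (-σ) * S.ncard := by
        gcongr
      linarith
    · rw [div_le_one hpos, ← haddR]
      exact le_add_of_nonneg_right (Nat.cast_nonneg _)
  refine tendsto_of_tendsto_of_tendsto_of_le_of_le' hlim tendsto_const_nhds ?_ ?_
  · filter_upwards [Filter.eventually_ge_atTop 1] with R hR using (hfacts R hR).1
  · filter_upwards [Filter.eventually_ge_atTop 1] with R hR using (hfacts R hR).2

end ZoneData

/-- There is a choice of the constants `C_j`, `D_j`, depending only on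
`d, ε, δ, τ, 𝔠, 𝔉`, such that the extended blocks `E⁽⁰⁾`, `E⁽ᵈ⁾` and `E⁽ˢ⁾_M` form a
partition of `E`; moreover `E⁽ᵈ⁾` is finite with cardinality bounded by `n*(𝔠,𝔉)`, and if
`E = ℤ^d` then `E⁽⁰⁾` has density one at infinity. -/
theorem statement0 (d : ℕ) (δ ε τ : ℝ) (hpar : ParamsOK d δ ε τ) :
    ∃ (Cfun Dfun : ℝ → ℝ → ℕ → ℝ) (nstar : ℝ → ℝ → ℕ),
      ∀ (g : PDForm d) (κ : Fin d → ℝ) (E : Set (Fin d → ℤ)),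
        let Z : ZoneData d :=
          ⟨g, κ, E, δ, ε, τ, Cfun (frakc g) (frakC g), Dfun (frakc g) (frakC g)⟩
        -- the chosen constants satisfy `1 = C₀ < C₁ < ⋯` and `1 = D₀ < D₁ < ⋯`
        SeqOK d Z.Cs Z.Ds ∧
        -- `E⁽⁰⁾` is disjoint from every `E⁽ˢ⁾_M`, `1 ≤ s ≤ d`
        (∀ (s : ℕ) (M : Submodule ℤ (Fin d → ℤ)),
          1 ≤ s → s ≤ d → IsSat M → zrank M = s → Disjoint Z.Z0 (Z.EM s M)) ∧
        -- distinct extended blocks are pairwise disjoint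
        (∀ (s s' : ℕ) (M M' : Submodule ℤ (Fin d → ℤ)),
          1 ≤ s → s ≤ d → IsSat M → zrank M = s →
          1 ≤ s' → s' ≤ d → IsSat M' → zrank M' = s' →
          (s ≠ s' ∨ M ≠ M') → Disjoint (Z.EM s M) (Z.EM s' M')) ∧
        -- the union of all the pieces is `E`
        (Z.Z0 ∪ ⋃ (s : ℕ) (M : Submodule ℤ (Fin d → ℤ))
            (_ : 1 ≤ s ∧ s ≤ d ∧ IsSat M ∧ zrank M = s), Z.EM s M) = E ∧
        -- `E⁽ᵈ⁾` is finite, with cardinality bounded by `n*(𝔠,𝔉)`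
        (Z.EM d ⊤).Finite ∧
        Nat.card (Z.EM d ⊤) ≤ nstar (frakc g) (frakC g) ∧
        -- if `E = ℤ^d` then `E⁽⁰⁾` has density one at infinity
        (E = Set.univ →
          Filter.Tendsto (fun R : ℝ =>
              (Nat.card {ξ : Fin d → ℤ | ξ ∈ Z.Z0 ∧ g.nrm (zc ξ) ≤ R} : ℝ) /
                (Nat.card {ξ : Fin d → ℤ | g.nrm (zc ξ) ≤ R} : ℝ))
            Filter.atTop (nhds 1)) := by
  have hd := hpar.1
  have hconst : ∀ c : ℝ, ∃ (Cs Ds : ℕ → ℝ) (N : ℕ), 0 < c →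
      Cs 0 = 1 ∧ Ds 0 = 1 ∧ StrictMono Cs ∧ StrictMono Ds ∧
      (∀ n, n + 1 < d →
        ResonanceTransfer d δ ε τ (√c) n (Cs n) (Ds n) (Cs (n + 1)) (Ds (n + 1))) ∧
      ∀ (g : PDForm d) (κ : Fin d → ℝ) (E : Set (Fin d → ℤ)),
        (∀ k : Fin d → ℤ, k ≠ 0 → √c ≤ g.nrm (zc k)) →
        ((⟨g, κ, E, δ, ε, τ, Cs, Ds⟩ : ZoneData d).EM d ⊤).Finite ∧
        Nat.card ((⟨g, κ, E, δ, ε, τ, Cs, Ds⟩ : ZoneData d).EM d ⊤) ≤ N := by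
    intro c
    by_cases hc : 0 < c
    · have hμ : 0 < √c := Real.sqrt_pos.2 hc
      obtain ⟨Cs, Ds, hC0, hD0, hC, hD, htr⟩ := exists_resonance_constants hpar hμ
      obtain ⟨R, hR⟩ := exists_nrm_le_of_mem_ZM_top hpar hμ hC0 hD0 hC hD
      refine ⟨Cs, Ds, (⌊2 * R / √c⌋₊ + 1) ^ d, fun _ => ⟨hC0, hD0, hC, hD, htr, ?_⟩⟩
      intro g κ E hmin
      exact finite_and_card_le_of_nrm_add_le g hμ hmin κ _ fun ξ hξ =>
        hR g κ E hmin ξ (ZoneData.mem_EM_iff.1 hξ).2.1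
    · exact ⟨0, 0, 0, fun h => absurd h hc⟩
  choose Cs Ds N hCDN using hconst
  refine ⟨fun c _ => Cs c, fun c _ => Ds c, fun c _ => N c, fun g κ E => ?_⟩
  obtain ⟨hC0, hD0, hC, hD, htr, hcard⟩ := hCDN (frakc g) (frakc_pos hd g)
  have hmin : ∀ k : Fin d → ℤ, k ≠ 0 → √(frakc g) ≤ g.nrm (zc k) := fun k hk =>
    sqrt_frakc_le g hk
  intro Z
  refine ⟨⟨hC0, hD0, fun j _ => hC (Nat.lt_succ_self j), fun j _ => hD (Nat.lt_succ_self j)⟩,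
    ?_, ?_, ZoneData.union_eq hC0 hD0, (hcard g κ E hmin).1, (hcard g κ E hmin).2,
    fun hE => Z.tendsto_density hpar hE⟩
  · intro s M _ _ _ _
    exact Set.disjoint_right.2 fun ξ hξ =>
      ZoneData.notMem_Z0_of_mem_ZM hC0 hD0 (ZoneData.mem_EM_iff.1 hξ).2.1
  · intro s s' M M' hs _ hM hr hs' _ hM' hr' hne
    rcases lt_trichotomy s s' with hlt | rfl | hlt
    · exact Set.disjoint_left.2 fun ξ hξ hξ' =>
        (ZoneData.mem_EM_iff.1 hξ').2.2 s hs hlt M hM hr hξ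
    · exact ZoneData.disjoint_EM_of_ne hpar (Real.sqrt_pos.2 (frakc_pos hd g)) hmin hC0 hC hD htr
        hs hM hr hM' hr' (hne.resolve_left fun h => h rfl)
    · exact Set.disjoint_left.2 fun ξ hξ hξ' =>
        (ZoneData.mem_EM_iff.1 hξ).2.2 s' hs' hlt M' hM' hr' hξ'
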